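/- arXiv:0704.3711 — 4 statements merged into one kernel-verified Lean document; each statement's English description precedes it below -/
import Mathlib

section
/- Let A be an AW*-algebra. Then A is finite (i.e., x*x = 1 implies xx* = 1 for all x ∈ A) if and only if every (not necessarily closed) right ideal I of A with ℓ_A(I) = {0} is algebraically essential in A. -/
variable {A : Type*} [CStarAlgebra A]

/-- A submodule `J ⊆ A` is a right ideal if it is closed under right multiplication
by arbitrary elements of `A`. -/
def IsRightIdeal (J : Submodule ℂ A) : Prop :=
  ∀ x ∈ J, ∀ a : A, x * a ∈ J

/-- A right ideal `J` is algebraically essential if it has nonzero intersection with every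
nonzero right ideal of `A`. -/
def IsAlgEssential (J : Submodule ℂ A) : Prop :=
  ∀ K : Submodule ℂ A, IsRightIdeal K → K ≠ ⊥ → J ⊓ K ≠ ⊥

/-- A unital C*-algebra is an AW*-algebra if the right annihilator of every subset is
generated, as a right ideal, by a projection. -/
def IsAWStar (A : Type*) [CStarAlgebra A] : Prop :=
  ∀ S : Set A, ∃ p : A, star p = p ∧ p * p = p ∧
    ∀ a : A, (∀ s ∈ S, s * a = 0) ↔ ∃ b : A, a = p * b

namespace AWStar

lemma exists_maximal_pairwise {α : Type*} (P : Set α) (R : α → α → Prop) :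
    ∃ M ⊆ P, M.Pairwise R ∧ ∀ a ∈ P, (∀ b ∈ M, R a b ∧ R b a) → a ∈ M := by
  obtain ⟨M, hM⟩ := zorn_subset {M : Set α | M ⊆ P ∧ M.Pairwise R} fun c hc hchain =>
    ⟨⋃₀ c, ⟨Set.sUnion_subset fun s hs => (hc hs).1,
      (Set.pairwise_sUnion hchain.directedOn).2 fun s hs => (hc hs).2⟩,
      fun s hs => Set.subset_sUnion_of_mem hs⟩
  refine ⟨M, hM.prop.1, hM.prop.2, fun a ha h => ?_⟩
  exact hM.le_of_ge ⟨Set.insert_subset ha hM.prop.1, hM.prop.2.insert fun b hb _ => h b hb⟩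
    (Set.subset_insert a M) (Set.mem_insert a M)

/-- Every type has a well-order whose initial segments have smaller cardinality. -/
lemma exists_wellOrder_segments_lt (S : Type*) :
    ∃ r : S → S → Prop, IsWellOrder S r ∧ ∀ i, Cardinal.mk {j | r j i} < Cardinal.mk S := by
  obtain ⟨r, hr, h⟩ := Cardinal.exists_ord_eq S
  exact ⟨r, hr, fun i => Cardinal.card_typein_lt i h⟩

/-- For nonzero `x`, the element `b` inverts `|x|` on the range of the nonzero element `f`; both
are obtained from `star x * x` by continuous functional calculus. -/
lemma exists_spectral_cut {x : A} (hx : x ≠ 0) :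
    ∃ b f : A, star b = b ∧ star f = f ∧ f ≠ 0 ∧ Commute b (star x * x) ∧
      star x * x * (b * b) * f = f := by
  have : Nontrivial A := ⟨x, 0, hx⟩
  set h := star x * x with hh
  have hsa : IsSelfAdjoint h := IsSelfAdjoint.star_mul_self x
  have hn : 0 < ‖h‖ := by
    rw [norm_pos_iff, hh]
    exact fun h0 => hx (CStarRing.star_mul_self_eq_zero_iff x |>.1 h0)
  have hmem : ‖h‖ ∈ spectrum ℝ h := by
    rcases CStarAlgebra.norm_or_neg_norm_mem_spectrum hsa with h1 | h1
    · exact h1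
    · have := spectrum_star_mul_self_nonneg _ h1
      linarith
  set n := ‖h‖
  let φ : ℝ → ℝ := fun t => max 0 (t - n / 2)
  let γ : ℝ → ℝ := fun t => (√(max t (n / 2)))⁻¹
  have hφ : Continuous φ := by fun_prop
  have hγ : Continuous γ := by
    refine Continuous.inv₀ (by fun_prop) fun t => ?_
    have : 0 < max t (n / 2) := lt_max_of_lt_right (by linarith)
    positivity
  refine ⟨cfc γ h, cfc φ h, IsSelfAdjoint.cfc, IsSelfAdjoint.cfc, ?_, ?_, ?_⟩
  · intro h0
    have h1 : φ n ∈ spectrum ℝ (cfc φ h) := by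
      rw [cfc_map_spectrum φ h]
      exact ⟨n, hmem, rfl⟩
    rw [h0, spectrum.zero_eq] at h1
    have h2 : max 0 (n - n / 2) = 0 := h1
    have := le_max_right 0 (n - n / 2)
    linarith
  · exact (Commute.refl h).cfc_real γ
  · have h1 : cfc (fun t : ℝ => t * (γ t * γ t) * φ t) h = h * (cfc γ h * cfc γ h) * cfc φ h := by
      rw [cfc_mul (fun t : ℝ => t * (γ t * γ t)) φ h (by fun_prop) (by fun_prop),
        cfc_mul (fun t : ℝ => t) (fun t => γ t * γ t) h (by fun_prop) (by fun_prop),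
        cfc_mul γ γ h (by fun_prop) (by fun_prop), cfc_id' ℝ h]
    rw [← h1]
    congr 1
    funext t
    by_cases ht : t ≤ n / 2
    · have : φ t = 0 := max_eq_left (by linarith)
      simp [this]
    · push Not at ht
      have h2 : γ t = (√t)⁻¹ := by simp only [γ, max_eq_left ht.le]
      have ht0 : 0 < t := by linarith
      rw [h2, ← mul_inv, Real.mul_self_sqrt ht0.le, mul_inv_cancel₀ ht0.ne', one_mul]

/-- The absolute value of a self-adjoint element. -/
lemma exists_abs {a : A} (ha : star a = a) :
    ∃ m : A, star m = m ∧ m * m = a * a ∧ ∀ b, Commute (a * a) b → Commute m b := by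
  have hsa : IsSelfAdjoint (a * a) := by
    rw [IsSelfAdjoint, star_mul, ha]
  refine ⟨cfc Real.sqrt (a * a), IsSelfAdjoint.cfc, ?_, fun b hb => hb.cfc_real _⟩
  rw [← cfc_mul Real.sqrt Real.sqrt (a * a) (by fun_prop) (by fun_prop)]
  conv_rhs => rw [← cfc_id' ℝ (a * a)]
  refine cfc_congr fun t ht => Real.mul_self_sqrt ?_
  have h1 : a * a = star a * a := by rw [ha]
  rw [h1] at ht
  exact spectrum_star_mul_self_nonneg _ ht

lemma mul_star_self_eq_zero {a : A} : a * star a = 0 ↔ a = 0 :=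
  CStarRing.mul_star_self_eq_zero_iff a

lemma star_mul_self_eq_zero {a : A} : star a * a = 0 ↔ a = 0 :=
  CStarRing.star_mul_self_eq_zero_iff a

/-- The projections of a C*-algebra. -/
@[ext]
structure Proj (A : Type*) [CStarAlgebra A] where
  /-- The underlying element of the algebra. -/
  val : A
  star_val : star val = val
  mul_self : val * val = val

namespace Proj

instance : CoeOut (Proj A) A := ⟨Proj.val⟩

attribute [simp] Proj.star_val Proj.mul_self

variable {p q : Proj A}

@[simp] lemma mul_self_assoc (p : Proj A) (a : A) : p.val * (p.val * a) = p.val * a := by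
  rw [← mul_assoc, mul_self]

lemma mul_comm_of_mul_eq (h : q.val * p = p) : p.val * q = p := by
  simpa using congrArg star h

lemma mul_eq_zero_comm : p.val * q = 0 ↔ q.val * p = 0 := by
  constructor <;> intro h <;> simpa using congrArg star h

instance : PartialOrder (Proj A) where
  le p q := q.val * p = p
  le_refl p := p.mul_self
  le_trans p q r hpq hqr := by
    rw [← hpq, ← mul_assoc, hqr]
  le_antisymm p q hpq hqp := by
    ext
    rw [← hpq, mul_comm_of_mul_eq hqp]

lemma le_def : p ≤ q ↔ q.val * p = p := Iff.rfl

lemma le_iff_mul_eq : p ≤ q ↔ p.val * q = p :=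
  ⟨mul_comm_of_mul_eq, fun h => by simpa [le_def] using congrArg star h⟩

instance : Compl (Proj A) where
  compl p := ⟨1 - p, by simp, by simp [mul_sub, sub_mul]⟩

@[simp] lemma coe_compl (p : Proj A) : (pᶜ).val = 1 - p := rfl

@[simp] protected lemma compl_compl (p : Proj A) : pᶜᶜ = p := by
  ext; simp

lemma le_compl_iff : p ≤ qᶜ ↔ q.val * p = 0 := by
  simp [le_def, sub_mul]

lemma compl_le_compl_iff : pᶜ ≤ qᶜ ↔ q ≤ p := by
  rw [le_compl_iff, le_iff_mul_eq, coe_compl, mul_sub, mul_one, sub_eq_zero, eq_comm]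

/-- Murray-von Neumann equivalence of projections. -/
def Equivalent (p q : Proj A) : Prop := ∃ w : A, star w * w = p ∧ w * star w = q

lemma mul_eq_of_star_mul {w : A} (h : star w * w = p) : w * p.val = w := by
  have h1 : star (w * p.val - w) * (w * p.val - w) = 0 := by
    have h2 : star (w * p.val - w) * (w * p.val - w) =
        p * (star w * w) * p - p * (star w * w) - (star w * w) * p + star w * w := by
      simp only [star_sub, star_mul, star_val]
      noncomm_ring
    rw [h2, h]
    simp
  exact sub_eq_zero.1 (star_mul_self_eq_zero.1 h1)

lemma mul_eq_of_mul_star {w : A} (h : w * star w = q) : q.val * w = w := by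
  have := mul_eq_of_star_mul (w := star w) (p := q) (by rwa [star_star])
  simpa using congrArg star this

lemma Equivalent.symm (h : Equivalent p q) : Equivalent q p := by
  obtain ⟨w, h1, h2⟩ := h
  exact ⟨star w, by rwa [star_star], by rwa [star_star]⟩

lemma Equivalent.trans {r : Proj A} (h : Equivalent p q) (h' : Equivalent q r) :
    Equivalent p r := by
  obtain ⟨w, h1, h2⟩ := h
  obtain ⟨v, h3, h4⟩ := h'
  refine ⟨v * w, ?_, ?_⟩
  · rw [star_mul, mul_assoc, ← mul_assoc (star v), h3, mul_eq_of_mul_star h2, h1]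
  · rw [star_mul, mul_assoc, ← mul_assoc w, h2, ← mul_assoc, mul_eq_of_star_mul h3, h4]

/-- In a finite algebra no projection is equivalent to a proper subprojection. -/
lemma Equivalent.eq_of_le (hfin : ∀ x : A, star x * x = 1 → x * star x = 1)
    (h : Equivalent p q) (hqp : q ≤ p) : q = p := by
  obtain ⟨w, h1, h2⟩ := h
  have h3 := mul_eq_of_star_mul h1
  have h4 := mul_eq_of_mul_star h2
  have h5 : p.val * w = w := by rw [← h4, ← mul_assoc, le_def.1 hqp]
  have h6 : star w * p.val = star w := by simpa using congrArg star h5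
  have h7 : p.val * star w = star w := by simpa using congrArg star h3
  have h8 := hfin (w + (1 - p.val))
  simp only [star_add, star_sub, star_one, star_val, mul_add, add_mul, mul_sub, sub_mul, one_mul,
    mul_one, h1, h2, h3, h5, h6, h7, mul_self] at h8
  have h9 := h8 (by abel)
  ext
  rw [← sub_eq_zero]
  rw [← sub_eq_zero] at h9
  rw [← h9]
  abel

/-- The projection onto the graph of a partial isometry between orthogonal projections. -/
lemma exists_graph {w : A} (h1 : star w * w = p) (h2 : w * star w = q)
    (hpq : p.val * q = 0) : ∃ h : Proj A, h.val = (1 / 2 : ℂ) • (p + q + w + star w) ∧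
      p.val * h = (1 / 2 : ℂ) • (p + star w) ∧ q.val * h = (1 / 2 : ℂ) • (q + w) := by
  have hqp := mul_eq_zero_comm.1 hpq
  have h3 := mul_eq_of_star_mul h1
  have h4 := mul_eq_of_mul_star h2
  have h5 : p.val * w = 0 := by rw [← h4, ← mul_assoc, hpq, zero_mul]
  have h6 : w * q.val = 0 := by rw [← h3, mul_assoc, hpq, mul_zero]
  have h3' : p.val * star w = star w := by simpa using congrArg star h3
  have h4' : star w * q.val = star w := by simpa using congrArg star h4
  have h5' : star w * p.val = 0 := by simpa using congrArg star h5
  have h6' : q.val * star w = 0 := by simpa using congrArg star h6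
  have h7 : w * w = 0 := by
    calc w * w = w * (p * w) := by rw [← mul_assoc, h3]
      _ = 0 := by rw [h5, mul_zero]
  have h7' : star w * star w = 0 := by simpa using congrArg star h7
  refine ⟨⟨(1 / 2 : ℂ) • (p + q + w + star w), ?_, ?_⟩, rfl, ?_, ?_⟩
  · simp only [star_smul, star_add, star_val, star_star]
    rw [show star (1 / 2 : ℂ) = 1 / 2 by simp]
    congr 1
    abel
  · simp only [smul_mul_smul_comm, mul_add, add_mul, mul_self, hpq, hqp, h1, h2, h3, h4, h5, h6,
      h3', h4', h5', h6', h7, h7']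
    module
  · simp only [mul_smul_comm, mul_add, mul_self, hpq, h5, h3', add_zero]
  · simp only [mul_smul_comm, mul_add, mul_self, hqp, h4, h6', add_zero, zero_add]

lemma mul_eq_zero_of_le {p' q' : Proj A} (hp : p' ≤ p) (hq : q' ≤ q) (h : p.val * q = 0) :
    p'.val * q' = 0 := by
  rw [← le_iff_mul_eq.1 hp, ← le_def.1 hq, mul_assoc, ← mul_assoc p.val, h, zero_mul, mul_zero]

lemma mem_of_le {I : Submodule ℂ A} (hI : IsRightIdeal I) (h : p ≤ q) (hq : q.val ∈ I) :
    p.val ∈ I := by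
  rw [← le_def.1 h]
  exact hI _ hq _

variable [hA : Fact (IsAWStar A)]

/-- The projection generating the right annihilator of a set. -/
noncomputable def rightAnn (S : Set A) : Proj A :=
  ⟨(hA.out S).choose, (hA.out S).choose_spec.1, (hA.out S).choose_spec.2.1⟩

lemma rightAnn_mul_eq {S : Set A} {a : A} : (rightAnn S).val * a = a ↔ ∀ s ∈ S, s * a = 0 := by
  have h := (hA.out S).choose_spec.2.2 a
  rw [h]
  constructor
  · exact fun h => ⟨a, h.symm⟩
  · rintro ⟨b, rfl⟩
    exact (rightAnn S).mul_self_assoc b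

/-- The left support (range projection) of an element. -/
noncomputable def range (a : A) : Proj A := (rightAnn {star a})ᶜ

lemma mul_range_eq_zero {a b : A} : b * range a = 0 ↔ b * a = 0 := by
  have h : (rightAnn {star a}).val * star b = star b ↔ ∀ s ∈ ({star a} : Set A), s * star b = 0 :=
    rightAnn_mul_eq
  simp only [Set.mem_singleton_iff, forall_eq] at h
  rw [← star_mul, star_eq_zero, ← star_inj, star_mul] at h
  rw [← h, range, coe_compl, mul_sub, mul_one, sub_eq_zero, eq_comm]
  simp

lemma range_le_iff {a : A} : range a ≤ p ↔ p.val * a = a := by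
  have h : (1 - p.val) * range a = 0 ↔ (1 - p.val) * a = 0 := mul_range_eq_zero
  rw [sub_mul, sub_mul, one_mul, one_mul, sub_eq_zero, sub_eq_zero] at h
  rw [le_def, eq_comm, h, eq_comm]

lemma mul_eq_zero_iff_le {a : A} : a * p = 0 ↔ p ≤ (range (star a))ᶜ := by
  rw [le_compl_iff, mul_eq_zero_comm.symm, mul_range_eq_zero, ← star_inj]
  simp

noncomputable instance : InfSet (Proj A) where
  sInf S := rightAnn {a | ∃ p ∈ S, a = 1 - p.val}

lemma sInf_mul_eq {S : Set (Proj A)} {a : A} :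
    (sInf S).val * a = a ↔ ∀ p ∈ S, p.val * a = a := by
  refine rightAnn_mul_eq.trans ⟨fun h p hp => ?_, ?_⟩
  · have := h _ ⟨p, hp, rfl⟩
    rwa [sub_mul, one_mul, sub_eq_zero, eq_comm] at this
  · rintro h _ ⟨p, hp, rfl⟩
    rw [sub_mul, one_mul, h p hp, sub_self]

noncomputable instance : CompleteLattice (Proj A) :=
  completeLatticeOfInf (Proj A) fun S =>
    ⟨fun p hp => sInf_mul_eq.1 (sInf S).mul_self p hp, fun _ hq => sInf_mul_eq.2 fun _ hp => hq hp⟩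

lemma inf_mul_eq {a : A} : (p ⊓ q).val * a = a ↔ p.val * a = a ∧ q.val * a = a := by
  simp only [← range_le_iff, le_inf_iff]

lemma mul_iSup_eq_zero {ι : Sort*} {x : ι → Proj A} {a : A} :
    a * (⨆ i, x i).val = 0 ↔ ∀ i, a * x i = 0 := by
  simp only [mul_eq_zero_iff_le, iSup_le_iff]

lemma mul_sup_eq_zero {a : A} :
    a * (p ⊔ q).val = 0 ↔ a * p = 0 ∧ a * q = 0 := by
  simp only [mul_eq_zero_iff_le, sup_le_iff]

lemma mul_finsetSup_eq_zero {ι : Type*} {F : Finset ι} {x : ι → Proj A} {a : A} :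
    a * (F.sup x).val = 0 ↔ ∀ i ∈ F, a * x i = 0 := by
  simp only [mul_eq_zero_iff_le, Finset.sup_le_iff]

@[simp] lemma coe_bot : (⊥ : Proj A).val = 0 := by
  have h : (⊥ : Proj A) ≤ ⟨0, by simp, by simp⟩ := bot_le
  rw [le_def, zero_mul] at h
  exact h.symm

lemma eq_bot_iff_coe : p = ⊥ ↔ p.val = 0 := by
  rw [Proj.ext_iff, coe_bot]

lemma le_compl_self_iff : p ≤ pᶜ ↔ p = ⊥ := by
  rw [le_compl_iff, mul_self, eq_bot_iff_coe]

protected lemma compl_sup : (p ⊔ q)ᶜ = pᶜ ⊓ qᶜ := by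
  refine le_antisymm (le_inf (compl_le_compl_iff.2 le_sup_left)
    (compl_le_compl_iff.2 le_sup_right)) ?_
  rw [← compl_le_compl_iff, Proj.compl_compl]
  refine sup_le ?_ ?_ <;> rw [← compl_le_compl_iff, Proj.compl_compl]
  exacts [inf_le_left, inf_le_right]

lemma coe_sup_of_mul_eq_zero (h : p.val * q = 0) : (p ⊔ q).val = p + q := by
  have h' := mul_eq_zero_comm.1 h
  have h1 : p ⊔ q ≤ ⟨p + q, by simp, by simp [mul_add, add_mul, h, h']⟩ := by
    refine sup_le ?_ ?_ <;> simp [le_def, add_mul, h, h']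
  rw [le_iff_mul_eq] at h1
  rw [← h1, mul_add, le_def.1 (le_sup_left : p ≤ p ⊔ q), le_def.1 (le_sup_right : q ≤ p ⊔ q)]

lemma coe_inf_compl_of_le (h : p ≤ q) : (q ⊓ pᶜ).val = q - p := by
  have h' := le_iff_mul_eq.1 h
  rw [le_def] at h
  have h1 : (q ⊓ pᶜ).val * (q - p.val) = q - p.val :=
    inf_mul_eq.2 ⟨by simp [mul_sub, h], by simp [mul_sub, sub_mul, h']⟩
  rw [← h1, mul_sub, le_iff_mul_eq.1 (inf_le_left : q ⊓ pᶜ ≤ q)]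
  have h2 : (q ⊓ pᶜ).val * p = 0 := by
    rw [mul_eq_zero_comm, ← le_compl_iff]; exact inf_le_right
  rw [h2, sub_zero]

lemma disjoint_compl_self : Disjoint p pᶜ := by
  rw [disjoint_iff, eq_bot_iff_coe]
  have h : p.val * (p ⊓ pᶜ) = 0 := by rw [← le_compl_iff]; exact inf_le_right
  rwa [le_def.1 (inf_le_left : p ⊓ pᶜ ≤ p)] at h

lemma disjoint_of_mul_eq_zero (h : p.val * q = 0) : Disjoint p q :=
  (disjoint_compl_self (p := p)).mono_right (le_compl_iff.2 h)

/-- The sign `u` of `p + q - 1` intertwines `p` and `q`; its square `r` is the support of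
`p + q - 1`. -/
lemma exists_sign (p q : Proj A) : ∃ (u : A) (r : Proj A), star u = u ∧ u * u = r ∧
    p.val * u = u * q ∧ (∀ b : A, r * b = 0 ↔ (p.val + q - 1) * b = 0) := by
  set a : A := p.val + q - 1 with ha
  have hsa : star a = a := by simp [ha]
  have hpa : p.val * a = a * q := by simp [ha, mul_sub, mul_add, sub_mul, add_mul]
  have hqa : q.val * a = a * p := by simp [ha, mul_sub, mul_add, sub_mul, add_mul]
  clear_value a
  obtain ⟨m, hm, hmm, hcomm⟩ := exists_abs hsa
  have hma : m * a = a * m := hcomm a (by rw [Commute, SemiconjBy, mul_assoc])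
  have hmq : m * q.val = q.val * m := hcomm q (by
    rw [Commute, SemiconjBy, mul_assoc, ← hpa, ← mul_assoc, ← hqa, mul_assoc])
  set s := range (m + a)
  set t := range (m - a)
  have hs : s.val * (m + a) = m + a := range_le_iff.1 le_rfl
  have ht : t.val * (m - a) = m - a := range_le_iff.1 le_rfl
  have h1 : (m + a) * t = 0 := by
    rw [mul_range_eq_zero, add_mul, mul_sub, mul_sub, hmm, hma]; abel
  have h2 : (m - a) * s = 0 := by
    rw [mul_range_eq_zero, sub_mul, mul_add, mul_add, hmm, hma]; abel
  have h1' : t.val * (m + a) = 0 := by simpa [hm, hsa] using congrArg star h1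
  have h2' : s.val * (m - a) = 0 := by simpa [hm, hsa] using congrArg star h2
  have hts : t.val * s = 0 := mul_range_eq_zero.2 h1'
  have hst : s.val * t = 0 := mul_eq_zero_comm.1 hts
  have hr : (s ⊔ t).val = s + t := coe_sup_of_mul_eq_zero hst
  have hum : (s.val - t) * m = a := by
    rw [mul_add] at hs h1'
    rw [mul_sub] at ht h2'
    have h3 : (2 : ℕ) • ((s.val - t) * m) = (2 : ℕ) • a := by
      calc (2 : ℕ) • ((s.val - t) * m)
          = (s * m + s * a) + (s * m - s * a) - (t * m + t * a) - (t * m - t * a) := by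
            noncomm_ring
        _ = (2 : ℕ) • a := by rw [hs, ht, h1', h2']; abel
    have h4 : (2 : ℂ) • ((s.val - t) * m) = (2 : ℂ) • a := by
      simpa only [two_smul] using h3
    exact smul_right_injective A (two_ne_zero (α := ℂ)) h4
  have hmu : m * (s.val - t) = a := by simpa [hm, hsa] using congrArg star hum
  have key : ∀ y : A, y * m = 0 → y * (s ⊔ t).val = 0 := by
    intro y hy
    have hya : y * a = 0 := by rw [← hmu, ← mul_assoc, hy, zero_mul]
    rw [mul_sup_eq_zero, mul_range_eq_zero, mul_range_eq_zero, mul_add, mul_sub, hy, hya]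
    simp
  have key' : ∀ b : A, m * b = 0 → (s ⊔ t).val * b = 0 := by
    intro b hb
    have := key (star b) (by simpa [hm] using congrArg star hb)
    simpa using congrArg star this
  have hmr : m * (s ⊔ t).val = m := by
    have h3 : (m + a) * s = m + a := by simpa [hm, hsa] using congrArg star hs
    have h4 : (m - a) * t = m - a := by simpa [hm, hsa] using congrArg star ht
    have h5 : (2 : ℂ) • (m * (s ⊔ t).val) = (2 : ℂ) • m := by
      rw [two_smul, two_smul, hr]
      calc m * (s.val + t) + m * (s.val + t)
          = (m + a) * s + (m - a) * s + (m + a) * t + (m - a) * t := by noncomm_ring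
        _ = m + m := by rw [h1, h2, h3, h4]; abel
    exact smul_right_injective A (two_ne_zero (α := ℂ)) h5
  have hmker : ∀ b : A, (s ⊔ t).val * b = 0 → m * b = 0 := by
    intro b hb
    rw [← hmr, mul_assoc, hb, mul_zero]
  have hur : (s.val - t) * (s ⊔ t).val = s - t := by
    simp [hr, mul_add, add_mul, hst, hts, sub_eq_add_neg]
  have hqr : q.val * (s ⊔ t).val = (s ⊔ t).val * q := by
    have h3 : (s ⊔ t).val * (q * (1 - (s ⊔ t).val)) = 0 := by
      apply key'
      rw [← mul_assoc, hmq, mul_assoc, hmker _ (by rw [mul_sub, mul_self, mul_one, sub_self]),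
        mul_zero]
    rw [mul_sub, mul_one, mul_sub, sub_eq_zero] at h3
    have h4 := congrArg star h3
    simp only [star_mul, star_val, mul_assoc] at h4
    exact h4.trans h3.symm
  refine ⟨s - t, s ⊔ t, by simp, ?_, ?_, ?_⟩
  · simp [hr, mul_sub, sub_mul, hst, hts]
  · have h3 : (p.val * (s - t) - (s - t) * q) * m = 0 := by
      rw [sub_mul, mul_assoc, mul_assoc _ q.val, hum, ← hmq, ← mul_assoc, hum, hpa, sub_self]
    have h4 := key _ h3
    rwa [sub_mul, mul_assoc, hur, mul_assoc _ q.val, hqr, ← mul_assoc _ (s ⊔ t).val, hur,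
      sub_eq_zero] at h4
  · refine fun b => ⟨fun hb => ?_, fun hb => key' b ?_⟩
    · rw [← hum, mul_assoc, hmker b hb, mul_zero]
    · have h3 : star (m * b) * (m * b) = 0 := by
        rw [star_mul, hm, mul_assoc, ← mul_assoc m, hmm, mul_assoc a, hb, mul_zero, mul_zero]
      exact star_mul_self_eq_zero.1 h3

lemma equivalent_inf_compl (p q : Proj A) :
    Equivalent (p ⊓ (p ⊓ qᶜ)ᶜ) (q ⊓ (q ⊓ pᶜ)ᶜ) := by
  obtain ⟨u, r, hu, huu, hpu, hker⟩ := exists_sign p q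
  have hup : u * p.val = q * u := by simpa [hu] using congrArg star hpu
  have hpr : p.val * r = r * p := by
    rw [← huu, ← mul_assoc, hpu, mul_assoc, ← hup, mul_assoc]
  have hqr : q.val * r = r * q := by
    rw [← huu, ← mul_assoc, ← hup, mul_assoc, hpu, mul_assoc]
  have aux : ∀ p q : Proj A, p.val * r = r * p →
      (∀ b : A, r * b = 0 ↔ (p.val + q - 1) * b = 0) → (p ⊓ (p ⊓ qᶜ)ᶜ).val = p.val * r := by
    intro p q hpr hker
    have h1 : q.val * (p * (1 - r)) = 0 := by
      have h2 := (hker (1 - r)).1 (by simp [mul_sub])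
      have h3 : q.val * ((p.val + q - 1) * (1 - r)) = 0 := by rw [h2, mul_zero]
      rw [← h3]
      simp [mul_sub, mul_add, sub_mul, add_mul]
    have h2 : (p ⊓ qᶜ).val * (p * (1 - r)) = p * (1 - r) :=
      inf_mul_eq.2 ⟨by simp, by rw [coe_compl, sub_mul, one_mul, h1, sub_zero]⟩
    have h3 : p.val * (p ⊓ qᶜ) = p ⊓ qᶜ := le_def.1 inf_le_left
    have h4 : q.val * (p ⊓ qᶜ) = 0 := le_compl_iff.1 inf_le_right
    have h5 : r.val * (p ⊓ qᶜ) = 0 := by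
      rw [hker, sub_mul, add_mul, h3, h4]; simp
    have h6 : (p * (1 - r)) * (p ⊓ qᶜ).val = (p ⊓ qᶜ).val := by
      rw [mul_assoc, sub_mul, h5, one_mul, sub_zero, h3]
    have h7 : (p ⊓ qᶜ).val = p * (1 - r) := by
      rw [← h2]
      have h8 := congrArg star h6
      simp only [star_mul, star_sub, star_one, star_val] at h8
      rw [mul_sub, mul_one, hpr]
      rw [sub_mul, one_mul] at h8
      exact h8.symm
    rw [coe_inf_compl_of_le inf_le_left, h7]
    simp [mul_sub]
  refine ⟨u * p, ?_, ?_⟩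
  · rw [aux p q hpr hker, star_mul, star_val, hu, mul_assoc, ← mul_assoc u, huu, ← hpr]
    simp
  · rw [aux q p hqr (by simpa only [add_comm] using hker), star_mul, star_val, hu, mul_assoc,
      mul_self_assoc, hpu, ← mul_assoc, huu, hqr]

/-- The parallelogram law. -/
lemma parallelogram (p q : Proj A) : Equivalent (p ⊓ (p ⊓ q)ᶜ) ((p ⊔ q) ⊓ qᶜ) := by
  have h := equivalent_inf_compl p qᶜ
  rwa [Proj.compl_compl, inf_comm qᶜ pᶜ, ← Proj.compl_sup (p := p), Proj.compl_compl,
    inf_comm qᶜ] at h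

lemma equivalent_of_disjoint (h : Disjoint p q) : Equivalent p ((p ⊔ q) ⊓ qᶜ) := by
  have h1 := parallelogram p q
  rwa [h.eq_bot, inf_eq_left.2 (le_compl_iff.2 (by simp))] at h1

lemma isModularLattice (hfin : ∀ x : A, star x * x = 1 → x * star x = 1) :
    IsModularLattice (Proj A) where
  sup_inf_le_assoc_of_le {x} y {z} hxz := by
    set c := x ⊔ y ⊓ z
    set d := (x ⊔ y) ⊓ z
    have hcd : c ≤ d := sup_le (le_inf le_sup_left hxz) (inf_le_inf_right z le_sup_right)
    have h1 : d ⊓ y = c ⊓ y := by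
      refine le_antisymm (le_inf ?_ inf_le_right) (inf_le_inf_right y hcd)
      exact le_sup_of_le_right (le_inf inf_le_right (inf_le_left.trans inf_le_right))
    have h2 : d ⊔ y = c ⊔ y := by
      refine le_antisymm (sup_le (inf_le_left.trans (sup_le ?_ le_sup_right)) le_sup_right)
        (sup_le_sup_right hcd y)
      exact le_sup_of_le_left le_sup_left
    have h3 := parallelogram d y
    rw [h1, h2] at h3
    have h4 := (h3.trans (parallelogram c y).symm).eq_of_le hfin (inf_le_inf_right _ hcd)
    have h5 := congrArg Proj.val h4
    rw [coe_inf_compl_of_le inf_le_left, coe_inf_compl_of_le (inf_le_left.trans hcd),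
      sub_left_inj] at h5
    exact (Proj.ext h5).ge

lemma iSup_mul_iSup_eq_zero {ι κ : Sort*} {x : ι → Proj A} {y : κ → Proj A}
    (h : ∀ i j, (x i).val * y j = 0) : (⨆ i, x i).val * (⨆ j, y j).val = 0 := by
  rw [mul_iSup_eq_zero]
  intro j
  rw [mul_eq_zero_comm, mul_iSup_eq_zero]
  exact fun i => mul_eq_zero_comm.1 (h i j)

lemma mul_iSup_of_forall_ne {ι : Type*} {x : ι → Proj A}
    (hx : Pairwise fun i j => (x i).val * x j = 0) {a : A} {j : ι}
    (ha : ∀ i, i ≠ j → a * x i = 0) : a * (⨆ i, x i).val = a * x j := by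
  have h : (a - a * x j) * (⨆ i, x i).val = 0 := by
    rw [mul_iSup_eq_zero]
    intro i
    rcases eq_or_ne i j with rfl | hij
    · rw [sub_mul, mul_assoc, mul_self, sub_self]
    · rw [sub_mul, mul_assoc, hx hij.symm, ha i hij, mul_zero, sub_zero]
  rwa [sub_mul, mul_assoc, le_iff_mul_eq.1 (le_iSup x j), sub_eq_zero] at h

/-- Equivalence is completely additive on orthogonal families with orthogonal suprema. -/
theorem iSup_equivalent {ι : Type*} {p q : ι → Proj A}
    (hp : Pairwise fun i j => (p i).val * p j = 0) (hq : Pairwise fun i j => (q i).val * q j = 0)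
    (hpq : ∀ i j, (p i).val * q j = 0) (h : ∀ i, Equivalent (p i) (q i)) :
    Equivalent (⨆ i, p i) (⨆ i, q i) := by
  choose w h1 h2 using h
  choose g hg hpg hqg using fun i => exists_graph (h1 i) (h2 i) (hpq i i)
  have hpw : ∀ i, p i * star (w i) = star (w i) := fun i => by
    simpa using congrArg star (mul_eq_of_star_mul (h1 i))
  have hqw : ∀ i, q i * w i = w i := fun i => mul_eq_of_mul_star (h2 i)
  have hqp : ∀ i j, (q i).val * p j = 0 := fun i j => mul_eq_zero_comm.1 (hpq j i)
  have hpg0 : ∀ i j, i ≠ j → (p i).val * g j = 0 := fun i j hij => by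
    rw [hg, mul_smul_comm, ← hpw j, ← hqw j]
    simp [mul_add, ← mul_assoc, hp hij, hpq]
  have hqg0 : ∀ i j, i ≠ j → (q i).val * g j = 0 := fun i j hij => by
    rw [hg, mul_smul_comm, ← hpw j, ← hqw j]
    simp [mul_add, ← mul_assoc, hq hij, hqp]
  have hgg : Pairwise fun i j => (g i).val * g j = 0 := fun i j hij => by
    have h3 : (p i).val * g i + (q i).val * g i = g i := by
      rw [hpg, hqg, hg]
      module
    have h4 : g i * (p i).val + g i * (q i).val = g i := by simpa using congrArg star h3
    change (g i).val * g j = 0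
    rw [← h4, add_mul, mul_assoc, mul_assoc, hpg0 i j hij, hqg0 i j hij]
    simp
  set e := ⨆ i, p i
  set f := ⨆ i, q i
  set G := ⨆ i, g i
  have hpG : ∀ i, G * (p i).val = (1 / 2 : ℂ) • (p i + w i) := fun i => by
    have h3 := mul_iSup_of_forall_ne hgg (a := p i) (j := i) fun j hj => hpg0 i j hj.symm
    rw [hpg] at h3
    simpa using congrArg star h3
  have hqG : ∀ i, G * (q i).val = (1 / 2 : ℂ) • (q i + star (w i)) := fun i => by
    have h3 := mul_iSup_of_forall_ne hgg (a := q i) (j := i) fun j hj => hqg0 i j hj.symm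
    rw [hqg] at h3
    simpa using congrArg star h3
  have hep : ∀ i, e * (p i).val = p i := fun i => le_def.1 (le_iSup p i)
  have hfq : ∀ i, f * (q i).val = q i := fun i => le_def.1 (le_iSup q i)
  have hfe : f.val * e = 0 := iSup_mul_iSup_eq_zero hqp
  have hfp : ∀ i, f * (p i).val = 0 := fun i => by rw [← hep, ← mul_assoc, hfe, zero_mul]
  have heq : ∀ i, e * (q i).val = 0 := fun i => by
    rw [← hfq, ← mul_assoc, mul_eq_zero_comm.1 hfe, zero_mul]
  have hfw : ∀ i, f * w i = w i := fun i => by rw [← hqw, ← mul_assoc, hfq]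
  have hew : ∀ i, e * star (w i) = star (w i) := fun i => by rw [← hpw, ← mul_assoc, hep]
  set v : A := (2 : ℂ) • (f * G * e) with hv
  have hvp : ∀ i, v * p i = w i := fun i => by
    rw [hv, smul_mul_assoc, mul_assoc, hep, mul_assoc, hpG, mul_smul_comm, mul_add, hfp, hfw,
      smul_smul]
    norm_num
  have hv' : star v = (2 : ℂ) • (e * G * f) := by
    rw [hv]
    simp [mul_assoc]
  have hvq : ∀ i, star v * q i = star (w i) := fun i => by
    rw [hv', smul_mul_assoc, mul_assoc, hfq, mul_assoc, hqG, mul_smul_comm, mul_add, heq, hew,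
      smul_smul]
    norm_num
  have hve : v * e = v := by rw [hv, smul_mul_assoc, mul_assoc, mul_self]
  have hvf : star v * f = star v := by rw [hv', smul_mul_assoc, mul_assoc, mul_self]
  refine ⟨v, ?_, ?_⟩
  · have h3 : (star v * v - 1) * e = 0 := by
      rw [mul_iSup_eq_zero]
      intro i
      rw [sub_mul, mul_assoc, hvp, ← hqw, ← mul_assoc, hvq, h1, one_mul, sub_self]
    rwa [sub_mul, mul_assoc, hve, one_mul, sub_eq_zero] at h3
  · have h3 : (v * star v - 1) * f = 0 := by
      rw [mul_iSup_eq_zero]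
      intro i
      rw [sub_mul, mul_assoc, hvq, ← hpw, ← mul_assoc, hvp, h2, one_mul, sub_self]
    rwa [sub_mul, mul_assoc, hvf, one_mul, sub_eq_zero] at h3

/-- A family is upper continuous if disjointness from all its finite suprema implies disjointness
from its supremum. -/
def UpperContinuous {ι : Type*} (x : ι → Proj A) : Prop :=
  ∀ g, (∀ F : Finset ι, Disjoint g (F.sup x)) → Disjoint g (⨆ i, x i)

/-- In a finite algebra, an orthogonal family with an orthogonal equivalent copy is upper
continuous. -/
theorem upperContinuous_of_equivalent [IsModularLattice (Proj A)]
    (hfin : ∀ x : A, star x * x = 1 → x * star x = 1) {ι : Type*} {x y : ι → Proj A}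
    (hx : Pairwise fun i j => (x i).val * x j = 0) (hy : Pairwise fun i j => (y i).val * y j = 0)
    (hyx : ∀ i j, (y i).val * x j = 0) (h : ∀ i, Equivalent (y i) (x i)) :
    UpperContinuous x := by
  intro g hg
  suffices H : ∀ S : Set ι, Disjoint g (⨆ i ∈ S, x i) by simpa using H Set.univ
  intro S
  induction S using (InvImage.wf (fun S : Set ι => Cardinal.mk S) Cardinal.lt_wf).induction with
  | _ S ih =>
  rcases S.finite_or_infinite with hS | hS
  · refine (hg hS.toFinset).mono_right (iSup₂_le fun i hi => Finset.le_sup (by simpa using hi))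
  obtain ⟨r, hr, hrS⟩ := exists_wellOrder_segments_lt S
  set X := ⨆ i ∈ S, x i with hX
  set g' := g ⊓ X
  set lo : S → Proj A := fun i => ⨆ j ∈ {j | r j i}, x j
  have hle : ∀ i : S, x i ≤ X := fun i => le_iSup₂_of_le i.1 i.2 le_rfl
  have hlo_le : ∀ i j, r j i → x j ≤ lo i := fun i j hj => le_iSup₂_of_le j hj le_rfl
  have hloX : ∀ i, lo i ≤ X := fun i => iSup₂_le fun j _ => hle j
  have hdisj : ∀ i, Disjoint g' (lo i ⊔ x i) := by
    intro i
    have h1 := ih (Subtype.val '' (insert i {j | r j i})) (by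
      change Cardinal.mk _ < Cardinal.mk S
      rw [Cardinal.mk_image_eq Subtype.val_injective]
      refine (Cardinal.mk_insert_le).trans_lt ?_
      have : Infinite S := hS.to_subtype
      exact Cardinal.add_lt_of_lt (Cardinal.aleph0_le_mk S) (hrS i)
        (Cardinal.one_lt_aleph0.trans_le (Cardinal.aleph0_le_mk S)))
    rw [iSup_image, iSup_insert, sup_comm] at h1
    exact h1.mono_left inf_le_left
  have hlox : ∀ i, Disjoint (lo i) (x i) := fun i => by
    refine disjoint_of_mul_eq_zero ?_
    rw [mul_eq_zero_comm, mul_iSup_eq_zero]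
    intro j
    rw [mul_iSup_eq_zero]
    intro hj
    refine hx fun hij => ?_
    obtain rfl : i = j := Subtype.ext hij
    exact irrefl_of r i hj
  set k : S → Proj A := fun i => (x i ⊔ (g' ⊔ lo i)) ⊓ (g' ⊔ lo i)ᶜ
  have hxk : ∀ i : S, Equivalent (x i) (k i) := fun i =>
    equivalent_of_disjoint
      (Disjoint.disjoint_sup_left_of_disjoint_sup_right (hlox i) (hdisj i)).symm
  have hkX : ∀ i, k i ≤ X := fun i =>
    inf_le_left.trans (sup_le (hle i) (sup_le inf_le_right (hloX i)))
  have hkk' : ∀ i j : S, r j i → (k j).val * k i = 0 := by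
    intro i j hji
    rw [← le_compl_iff]
    refine (inf_le_right : k i ≤ (g' ⊔ lo i)ᶜ).trans (compl_le_compl_iff.2 ?_)
    refine (inf_le_left : k j ≤ x j ⊔ (g' ⊔ lo j)).trans (sup_le ?_ (sup_le ?_ ?_))
    · exact le_sup_of_le_right (hlo_le i j hji)
    · exact le_sup_left
    · exact le_sup_of_le_right (iSup₂_le fun l hl => hlo_le i l (trans_of r hl hji))
  have hkk : Pairwise fun i j : S => (k i).val * k j = 0 := by
    intro i j hij
    rcases trichotomous_of r i j with hr' | hr' | hr'
    · exact hkk' j i hr'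
    · exact absurd hr' hij
    · exact mul_eq_zero_comm.1 (hkk' i j hr')
  have hyX : ∀ i : S, (y i).val * X = 0 := fun i => by
    rw [mul_iSup_eq_zero]
    intro j
    rw [mul_iSup_eq_zero]
    exact fun _ => hyx i j
  have hyS : Pairwise fun i j : S => (y i).val * y j = 0 := fun i j hij =>
    hy (Subtype.coe_ne_coe.2 hij)
  have e1 := iSup_equivalent hyS hkk
    (fun i j => by rw [← le_def.1 (hkX j), ← mul_assoc, hyX, zero_mul])
    (fun i => (h i).trans (hxk i))
  have e2 := iSup_equivalent hyS (fun i j hij => hx (Subtype.coe_ne_coe.2 hij))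
    (fun i j => hyx i j) (fun i : S => h i)
  rw [iSup_subtype (p := (· ∈ S)) (f := fun i => x i)] at e2
  have h1 : ⨆ i, k i = X := (e2.symm.trans e1).eq_of_le hfin (iSup_le hkX)
  rw [disjoint_iff, ← le_compl_self_iff]
  refine (inf_le_right : g' ≤ X).trans (h1.ge.trans (iSup_le fun i => ?_))
  exact inf_le_right.trans (compl_le_compl_iff.2 le_sup_left)

lemma UpperContinuous.sum [IsModularLattice (Proj A)] {ι κ : Type*} {x : ι → Proj A}
    {y : κ → Proj A} (hx : UpperContinuous x) (hy : UpperContinuous y)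
    (h : Disjoint (⨆ i, x i) (⨆ j, y j)) : UpperContinuous (Sum.elim x y) := by
  intro g hg
  rw [iSup_sum]
  simp only [Sum.elim_inl, Sum.elim_inr]
  have hg' : ∀ (F : Finset ι) (G : Finset κ), Disjoint g (F.sup x ⊔ G.sup y) := fun F G => by
    have h1 := hg (F.disjSum G)
    rwa [Finset.sup_disjSum] at h1
  have hF : ∀ F : Finset ι, F.sup x ≤ ⨆ i, x i := fun F => Finset.sup_le fun i _ => le_iSup x i
  have hG : ∀ G : Finset κ, G.sup y ≤ ⨆ j, y j := fun G => Finset.sup_le fun j _ => le_iSup y j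
  have h1 : ∀ F : Finset ι, Disjoint (F.sup x ⊔ g) (⨆ j, y j) := fun F => by
    rw [sup_comm]
    exact hy _ fun G =>
      Disjoint.disjoint_sup_left_of_disjoint_sup_right (h.mono (hF F) (hG G)) (hg' F G)
  have h2 : Disjoint (g ⊔ ⨆ j, y j) (⨆ i, x i) := hx _ fun F => by
    have h3 : Disjoint (F.sup x) g := by simpa using (hg' F ∅).symm
    exact (Disjoint.disjoint_sup_right_of_disjoint_sup_left h3 (h1 F)).symm
  rw [sup_comm]
  exact Disjoint.disjoint_sup_right_of_disjoint_sup_left (by simpa using h1 ∅) h2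

/-- A family of projections that are centrally orthogonal is upper continuous. -/
lemma upperContinuous_of_mul_mul_eq_zero {ι : Type*} {r : ι → Proj A}
    (hr : Pairwise fun i j => ∀ a : A, (r i).val * a * r j = 0) : UpperContinuous r := by
  intro g hg
  set R := ⨆ i, r i
  set k := g ⊓ R
  have hkR : k * R.val = k := le_iff_mul_eq.1 inf_le_right
  have hcomm : ∀ i, k * (r i).val = r i * k := by
    intro i
    have h1 : (r i).val * k * (1 - (r i).val) * R = 0 := by
      rw [mul_iSup_eq_zero]
      intro j
      rcases eq_or_ne i j with rfl | hij
      · rw [mul_assoc, sub_mul, one_mul, mul_self, sub_self, mul_zero]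
      · rw [mul_sub, mul_one, sub_mul, hr hij, mul_assoc _ k.val, mul_assoc, mul_assoc k.val,
          ← mul_one (r i).val, hr hij, mul_zero, mul_zero, sub_zero]
    rw [mul_sub, mul_one, sub_mul, mul_assoc, hkR, mul_assoc _ (r i).val,
      le_iff_mul_eq.1 (le_iSup r i), sub_eq_zero] at h1
    have h2 := congrArg star h1
    simp only [star_mul, star_val, ← mul_assoc] at h2
    rw [h2, ← h1]
  have hzero : ∀ i, k * (r i).val = 0 := by
    intro i
    have h1 : (g ⊓ r i).val * (k * (r i).val) = k * (r i).val := by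
      refine inf_mul_eq.2 ⟨?_, ?_⟩
      · rw [← mul_assoc, le_def.1 (inf_le_left : k ≤ g)]
      · rw [hcomm, mul_self_assoc]
    have h2 : g ⊓ r i = ⊥ := by simpa using (hg {i}).eq_bot
    rwa [h2, coe_bot, zero_mul, eq_comm] at h1
  rw [disjoint_iff, eq_bot_iff_coe, ← hkR, mul_iSup_eq_zero]
  exact hzero

/-- A nonzero element dominates a pair of equivalent nonzero projections on its two sides. -/
lemma exists_equivalent_of_ne_zero {x : A} (hx : x ≠ 0) :
    ∃ p q : Proj A, Equivalent p q ∧ p ≠ ⊥ ∧ q ≠ ⊥ ∧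
      (∃ c, p.val = x * c) ∧ ∃ d, q.val = star x * d := by
  obtain ⟨b, f, hb, -, hf0, hcomm, hf⟩ := exists_spectral_cut hx
  set q := range f
  have hqf : q * f = f := range_le_iff.1 le_rfl
  have h1 : star x * x * (b * b) * q = q := by
    have h2 : (star x * x * (b * b) - 1) * range f = 0 := by
      rw [mul_range_eq_zero, sub_mul, hf, one_mul, sub_self]
    rwa [sub_mul, one_mul, sub_eq_zero] at h2
  have hq0 : q.val ≠ 0 := fun h => hf0 (by rw [← hqf, h, zero_mul])
  set w := x * b * q with hw
  have hww : star w * w = q := by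
    calc star w * w = q * (b * (star x * x) * b * q) := by simp [hw, hb, mul_assoc]
      _ = q * (star x * x * (b * b) * q) := by rw [hcomm.eq]; simp only [mul_assoc]
      _ = q := by rw [h1, mul_self]
  have hwq : w * q.val = w := mul_eq_of_star_mul hww
  let p : Proj A := ⟨w * star w, by simp, by
    rw [mul_assoc, ← mul_assoc (star w), hww, ← mul_assoc, hwq]⟩
  have hwp : w * star w = p.val := rfl
  refine ⟨p, q, Equivalent.symm ⟨w, hww, hwp⟩, ?_, fun h => hq0 (eq_bot_iff_coe.1 h), ?_, ?_⟩
  · rw [Ne, eq_bot_iff_coe, ← hwp, mul_star_self_eq_zero]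
    intro h
    rw [h, mul_zero] at hww
    exact hq0 hww.symm
  · exact ⟨b * q * star w, by rw [← hwp, hw]; simp only [mul_assoc]⟩
  · exact ⟨x * (b * b) * q, by rw [← mul_assoc, ← mul_assoc, h1]⟩

lemma finsetSup_mem {I : Submodule ℂ A} {ι : Type*} {x : ι → Proj A}
    (hx : Pairwise fun i j => (x i).val * x j = 0) (hxI : ∀ i, (x i).val ∈ I) (F : Finset ι) :
    (F.sup x).val ∈ I := by
  classical
  induction F using Finset.induction_on with
  | empty => simp
  | insert i F hi ih =>
    rw [Finset.sup_insert, coe_sup_of_mul_eq_zero]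
    · exact I.add_mem (hxI i) ih
    · rw [mul_finsetSup_eq_zero]
      intro j hj
      exact hx fun hij => hi (hij ▸ hj)

/-- In a finite algebra, every right ideal contains an upper continuous orthogonal family whose
supremum is orthogonal to no nonzero projection of the ideal. -/
lemma exists_upperContinuous_family.{u} {A : Type u} [CStarAlgebra A] [Fact (IsAWStar A)]
    [IsModularLattice (Proj A)]
    (hfin : ∀ x : A, star x * x = 1 → x * star x = 1) {I : Submodule ℂ A} (hI : IsRightIdeal I) :
    ∃ (ι : Type u) (z : ι → Proj A), UpperContinuous z ∧ (∀ F : Finset ι, (F.sup z).val ∈ I) ∧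
      ∀ s : Proj A, s.val ∈ I → (⨆ i, z i).val * s = 0 → s = ⊥ := by
  obtain ⟨M, hM, hMR, hMmax⟩ := exists_maximal_pairwise
    {a : Proj A × Proj A | Equivalent a.1 a.2 ∧ a.1.val * a.2 = 0 ∧ a.1.val ∈ I ∧ a.2.val ∈ I}
    fun a b => a.1.val * b.1 = 0 ∧ a.1.val * b.2 = 0 ∧ a.2.val * b.1 = 0 ∧ a.2.val * b.2 = 0
  obtain ⟨L, hL, hLR, hLmax⟩ := exists_maximal_pairwise
    {r : Proj A | r.val ∈ I ∧ ∀ a ∈ M, r.val * a.1 = 0 ∧ r.val * a.2 = 0}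
    fun r s => r.val * s = 0
  let x : M → Proj A := fun a => a.1.1
  let y : M → Proj A := fun a => a.1.2
  let r : L → Proj A := fun r => r.1
  have hMR' : ∀ a b : M, a ≠ b → _ := fun a b hab => hMR a.2 b.2 (Subtype.coe_ne_coe.2 hab)
  have hx : Pairwise fun a b => (x a).val * x b = 0 := fun a b hab => (hMR' a b hab).1
  have hy : Pairwise fun a b => (y a).val * y b = 0 := fun a b hab => (hMR' a b hab).2.2.2
  have hxy : ∀ a b, (x a).val * y b = 0 := fun a b => by
    rcases eq_or_ne a b with rfl | hab
    · exact (hM a.2).2.1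
    · exact (hMR' a b hab).2.1
  have hyx : ∀ a b, (y a).val * x b = 0 := fun a b => mul_eq_zero_comm.1 (hxy b a)
  have hrx : ∀ i b, (r i).val * x b = 0 := fun i b => ((hL i.2).2 b b.2).1
  have hry : ∀ i b, (r i).val * y b = 0 := fun i b => ((hL i.2).2 b b.2).2
  have hrr : Pairwise fun i j => (r i).val * r j = 0 := fun i j hij =>
    hLR i.2 j.2 (Subtype.coe_ne_coe.2 hij)
  have hcentral : Pairwise fun i j => ∀ a : A, (r i).val * a * r j = 0 := by
    intro i j hij a
    by_contra h
    obtain ⟨p, q, hpq, hp0, -, ⟨c, hc⟩, ⟨d, hd⟩⟩ := exists_equivalent_of_ne_zero h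
    have hpi : p ≤ r i := by rw [le_def, hc]; simp only [mul_assoc, mul_self_assoc]
    have hqj : q ≤ r j := by
      rw [le_def, hd]; simp only [star_mul, star_val, mul_assoc, mul_self_assoc]
    have hmem : (p, q) ∈ M := by
      refine hMmax (p, q) ⟨hpq, mul_eq_zero_of_le hpi hqj (hrr hij), mem_of_le hI hpi (hL i.2).1,
        mem_of_le hI hqj (hL j.2).1⟩ fun b hb => ?_
      have h1 := (hL i.2).2 b hb
      have h2 := (hL j.2).2 b hb
      have h3 : p.val * b.1 = 0 := mul_eq_zero_of_le hpi le_rfl h1.1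
      have h4 : p.val * b.2 = 0 := mul_eq_zero_of_le hpi le_rfl h1.2
      have h5 : q.val * b.1 = 0 := mul_eq_zero_of_le hqj le_rfl h2.1
      have h6 : q.val * b.2 = 0 := mul_eq_zero_of_le hqj le_rfl h2.2
      exact ⟨⟨h3, h4, h5, h6⟩, mul_eq_zero_comm.1 h3, mul_eq_zero_comm.1 h5,
        mul_eq_zero_comm.1 h4, mul_eq_zero_comm.1 h6⟩
    have h7 := ((hL i.2).2 _ hmem).1
    rw [le_def.1 hpi, ← eq_bot_iff_coe] at h7
    exact hp0 h7
  have hxu : UpperContinuous x :=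
    upperContinuous_of_equivalent hfin hx hy hyx fun a => (hM a.2).1.symm
  have hyu : UpperContinuous y :=
    upperContinuous_of_equivalent hfin hy hx hxy fun a => (hM a.2).1
  have hru : UpperContinuous r := upperContinuous_of_mul_mul_eq_zero hcentral
  have hxyr : ∀ a i, (Sum.elim x y a).val * r i = 0 := by
    rintro (a | a) i
    exacts [mul_eq_zero_comm.1 (hrx i a), mul_eq_zero_comm.1 (hry i a)]
  refine ⟨_, Sum.elim (Sum.elim x y) r,
    (hxu.sum hyu (disjoint_of_mul_eq_zero (iSup_mul_iSup_eq_zero hxy))).sum hru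
      (disjoint_of_mul_eq_zero (iSup_mul_iSup_eq_zero hxyr)), finsetSup_mem ?_ ?_, ?_⟩
  · rintro ((a | a) | i) ((b | b) | j) hab
    · exact hx (by simpa using hab)
    · exact hxy a b
    · exact mul_eq_zero_comm.1 (hrx j a)
    · exact hyx a b
    · exact hy (by simpa using hab)
    · exact mul_eq_zero_comm.1 (hry j a)
    · exact hrx i b
    · exact hry i b
    · exact hrr (by simpa using hab)
  · rintro ((a | a) | i)
    exacts [(hM a.2).2.2.1, (hM a.2).2.2.2, (hL i.2).1]
  · intro s hsI hs
    have hsz : ∀ i, s.val * (Sum.elim (Sum.elim x y) r i).val = 0 := by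
      rw [← mul_iSup_eq_zero]
      exact mul_eq_zero_comm.1 hs
    have hsL : s ∈ L := by
      refine hLmax s ⟨hsI, fun a ha => ⟨hsz (.inl (.inl ⟨a, ha⟩)), hsz (.inl (.inr ⟨a, ha⟩))⟩⟩
        fun t ht => ?_
      have h1 : s.val * t = 0 := hsz (.inr ⟨t, ht⟩)
      exact ⟨h1, mul_eq_zero_comm.1 h1⟩
    have h1 : s.val * s = 0 := hsz (.inr ⟨s, hsL⟩)
    rwa [mul_self, ← eq_bot_iff_coe] at h1

end Proj

open Proj

/-- In a finite AW*-algebra, right ideals with zero left annihilator are essential. -/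
theorem isAlgEssential_of_finite (hAW : IsAWStar A)
    (hfin : ∀ x : A, star x * x = 1 → x * star x = 1) {I : Submodule ℂ A} (hI : IsRightIdeal I)
    (hann : ∀ b : A, (∀ x ∈ I, b * x = 0) → b = 0) : IsAlgEssential I := by
  have := Fact.mk hAW
  have := isModularLattice hfin
  obtain ⟨ι, z, hzu, hzI, hzmax⟩ := exists_upperContinuous_family hfin hI
  set t := ⨆ i, z i
  have hsub : ∀ g : Proj A, g ≠ ⊥ → g ≤ t → ∃ s : Proj A, s ≠ ⊥ ∧ s ≤ g ∧ s.val ∈ I := by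
    intro g hg0 hgt
    by_contra! h
    have hdisj : Disjoint g t := hzu g fun F => by
      by_contra hF
      exact h (g ⊓ F.sup z) (mt disjoint_iff.2 hF) inf_le_left (mem_of_le hI inf_le_right (hzI F))
    exact hg0 (hdisj.eq_bot_of_le hgt)
  have hIt : ∀ a ∈ I, t * a = 0 → a = 0 := by
    intro a ha hta
    by_contra ha0
    obtain ⟨p, -, -, hp0, -, ⟨c, hc⟩, -⟩ := exists_equivalent_of_ne_zero ha0
    exact hp0 (hzmax p (hc ▸ hI a ha c) (by rw [hc, ← mul_assoc, hta, zero_mul]))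
  have ht : 1 - t.val = 0 := by
    refine hann _ fun a ha => ?_
    set c := (1 - t.val) * a with hc
    by_contra hc0
    have hu : t * a * star c ≠ 0 := by
      intro hu
      have h1 := hIt (a * star c) (hI a ha _) (by rw [← mul_assoc, hu])
      refine hc0 (mul_star_self_eq_zero.1 ?_)
      nth_rw 1 [hc]
      rw [mul_assoc, h1, mul_zero]
    obtain ⟨g, -, -, hg0, -, ⟨d, hd⟩, -⟩ := exists_equivalent_of_ne_zero hu
    have hgt : g ≤ t := by rw [le_def, hd]; simp only [mul_assoc, mul_self_assoc]
    obtain ⟨s, hs0, hsg, hsI⟩ := hsub g hg0 hgt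
    have hts : t * s.val = s := le_def.1 (hsg.trans hgt)
    have h1 : t * (a * (star c * (d * s))) = s := by
      calc t * (a * (star c * (d * s))) = t * a * star c * d * s := by simp only [mul_assoc]
        _ = s := by rw [← hd, le_def.1 hsg]
    have h2 : a * (star c * (d * s)) = s := by
      refine sub_eq_zero.1 (hIt _ (I.sub_mem (hI a ha _) hsI) ?_)
      rw [mul_sub, h1, hts, sub_self]
    have h3 : c * (star c * (d * s)) = 0 := by
      nth_rw 1 [hc]
      rw [mul_assoc, h2, sub_mul, one_mul, hts, sub_self]
    have h4 : star c * (d * s) = 0 := by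
      rw [← star_mul_self_eq_zero, star_mul, star_star, mul_assoc, h3, mul_zero]
    rw [h4, mul_zero] at h2
    exact hs0 (eq_bot_iff_coe.2 h2.symm)
  intro K hK hK0
  obtain ⟨k, hk, hk0⟩ := K.ne_bot_iff.1 hK0
  obtain ⟨g, -, -, hg0, -, ⟨d, hd⟩, -⟩ := exists_equivalent_of_ne_zero hk0
  obtain ⟨s, hs0, hsg, hsI⟩ := hsub g hg0 (by rw [le_def, ← sub_eq_zero.1 ht, one_mul])
  have hsK : s.val ∈ K := mem_of_le hK hsg (hd ▸ hK k hk d)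
  exact (Submodule.ne_bot_iff _).2 ⟨s, ⟨hsI, hsK⟩, fun h => hs0 (eq_bot_iff_coe.2 h)⟩

section Isometry

variable {x : A}

lemma star_pow_mul_pow (hx : star x * x = 1) (n : ℕ) : star x ^ n * x ^ n = 1 := by
  induction n with
  | zero => simp
  | succ n ih =>
    rw [pow_succ, pow_succ', mul_assoc, ← mul_assoc (star x), hx, one_mul, ih]

lemma mul_star_pow_mul_pow_mul (hx : star x * x = 1) {m n : ℕ} (hmn : m ≠ n) :
    (1 - x * star x) * star x ^ m * (x ^ n * (1 - x * star x)) = 0 := by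
  have h1 : (1 - x * star x) * x = 0 := by rw [sub_mul, mul_assoc, hx]; simp
  have h2 : star x * (1 - x * star x) = 0 := by rw [mul_sub, ← mul_assoc, hx]; simp
  rcases hmn.lt_or_gt with h | h
  · obtain ⟨k, rfl⟩ := Nat.exists_eq_add_of_lt h
    rw [add_assoc, pow_add, mul_assoc, mul_assoc (x ^ m), ← mul_assoc (star x ^ m),
      star_pow_mul_pow hx, one_mul, pow_succ', ← mul_assoc, ← mul_assoc, h1, zero_mul, zero_mul]
  · obtain ⟨k, rfl⟩ := Nat.exists_eq_add_of_lt h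
    rw [add_assoc, add_comm, pow_add, mul_assoc, mul_assoc, ← mul_assoc (star x ^ n),
      star_pow_mul_pow hx, one_mul, pow_succ, mul_assoc, h2, mul_zero, mul_zero]

lemma mul_star_pow_mul_pow_mul_self (hx : star x * x = 1) (n : ℕ) :
    (1 - x * star x) * star x ^ n * (x ^ n * (1 - x * star x)) = 1 - x * star x := by
  rw [mul_assoc, ← mul_assoc (star x ^ n), star_pow_mul_pow hx, one_mul]
  simp [mul_sub, sub_mul, mul_assoc, ← mul_assoc (star x) x, hx]

/-- The elements annihilated by all but finitely many partial sums of `∑ (1 - x x*) x*ᵐ`. -/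
def partialSumIdeal (x : A) : Submodule ℂ A where
  carrier := {a | ∀ᶠ M in Filter.atTop,
    (∑ m ∈ Finset.range M, (1 - x * star x) * star x ^ m) * a = 0}
  zero_mem' := by simp
  add_mem' {a b} ha hb := by
    filter_upwards [ha, hb] with M h1 h2
    rw [mul_add, h1, h2, add_zero]
  smul_mem' c a ha := by
    filter_upwards [ha] with M h
    rw [mul_smul_comm, h, smul_zero]

lemma mem_partialSumIdeal {a : A} : a ∈ partialSumIdeal x ↔
    ∀ᶠ M in Filter.atTop, (∑ m ∈ Finset.range M, (1 - x * star x) * star x ^ m) * a = 0 := Iff.rfl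

lemma isRightIdeal_partialSumIdeal : IsRightIdeal (partialSumIdeal x) := by
  intro a ha b
  rw [mem_partialSumIdeal] at ha ⊢
  filter_upwards [ha] with M h
  rw [← mul_assoc, h, zero_mul]

lemma sum_mul_pow_mul (hx : star x * x = 1) {n M : ℕ} (h : n < M) :
    (∑ m ∈ Finset.range M, (1 - x * star x) * star x ^ m) * (x ^ n * (1 - x * star x)) =
      1 - x * star x := by
  rw [Finset.sum_mul, Finset.sum_eq_single_of_mem n (Finset.mem_range.2 h)
    fun m _ hmn => mul_star_pow_mul_pow_mul hx hmn, mul_star_pow_mul_pow_mul_self hx]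

lemma eq_zero_of_mem_partialSumIdeal (hx : star x * x = 1) {a : A} (ha : a ∈ partialSumIdeal x)
    (h : (1 - x * star x) * a = a) : a = 0 := by
  obtain ⟨M, h1, h2⟩ := (ha.and (Filter.eventually_gt_atTop 0)).exists
  have h3 := congrArg (· * a) (sum_mul_pow_mul hx h2)
  simp only [pow_zero, one_mul, mul_assoc, h, h1] at h3
  exact h3.symm

lemma pow_sub_pow_mem_partialSumIdeal (hx : star x * x = 1) (n : ℕ) :
    x ^ n * (1 - x * star x) - x ^ (n + 1) * (1 - x * star x) ∈ partialSumIdeal x := by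
  rw [mem_partialSumIdeal]
  filter_upwards [Filter.eventually_gt_atTop (n + 1)] with M hM
  rw [mul_sub, sum_mul_pow_mul hx hM, sum_mul_pow_mul hx (by omega), sub_self]

lemma eq_zero_of_mul_pow_mul_eq (hx : star x * x = 1) {b c : A}
    (h : ∀ n, b * (x ^ n * (1 - x * star x)) = c) : c = 0 := by
  set p := 1 - x * star x with hp
  have hps : star p = p := by simp [hp]
  have key : ∀ N : ℕ, (N : ℝ) ^ 2 * ‖c‖ ^ 2 ≤ ‖b‖ ^ 2 * (N * ‖p‖) := by
    intro N
    set S := ∑ n ∈ Finset.range N, x ^ n * p with hS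
    have h1 : b * S = N • c := by simp [hS, Finset.mul_sum, h]
    have h2 : star S * S = N • p := by
      have h3 : star S = ∑ m ∈ Finset.range N, p * star x ^ m := by simp [hS, hps]
      rw [h3]
      nth_rw 1 [hS]
      rw [Finset.mul_sum,
        Finset.sum_congr rfl fun n hn => sum_mul_pow_mul hx (Finset.mem_range.1 hn),
        Finset.sum_const, Finset.card_range]
    have h3 : ‖S‖ ^ 2 = N * ‖p‖ := by
      rw [sq, ← CStarRing.norm_star_mul_self, h2, ← Nat.cast_smul_eq_nsmul ℝ, norm_smul]
      simp
    have h4 : N * ‖c‖ ≤ ‖b‖ * ‖S‖ := by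
      have h5 := norm_mul_le b S
      rw [h1, ← Nat.cast_smul_eq_nsmul ℝ, norm_smul] at h5
      simpa using h5
    rw [← h3, ← mul_pow, ← mul_pow]
    gcongr
  by_contra hc
  have hc' : 0 < ‖c‖ ^ 2 := by have := norm_pos_iff.2 hc; positivity
  obtain ⟨N, hN⟩ := exists_nat_gt (‖b‖ ^ 2 * ‖p‖ / ‖c‖ ^ 2)
  have hN0 : (0 : ℝ) < N := lt_of_le_of_lt (by positivity) hN
  rw [div_lt_iff₀ hc'] at hN
  nlinarith [key N]

/-- The left annihilator of `partialSumIdeal x` vanishes. -/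
lemma eq_zero_of_mul_partialSumIdeal_eq_zero (hAW : IsAWStar A) (hx : star x * x = 1) {b : A}
    (hb : ∀ a ∈ partialSumIdeal x, b * a = 0) : b = 0 := by
  have : Fact (IsAWStar A) := ⟨hAW⟩
  set p := 1 - x * star x with hp
  have hps : star p = p := by simp [hp]
  have h1 : ∀ n, b * (x ^ n * p) = b * p := by
    intro n
    induction n with
    | zero => simp
    | succ n ih =>
      rw [← ih, eq_comm, ← sub_eq_zero, ← mul_sub]
      exact hb _ (pow_sub_pow_mem_partialSumIdeal hx n)
  have h2 : b * p = 0 := eq_zero_of_mul_pow_mul_eq hx h1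
  set q := rightAnn (Set.range fun n : ℕ => p * star x ^ n)
  have hq : ∀ n, p * star x ^ n * q = 0 := fun n => rightAnn_mul_eq.1 q.mul_self _ ⟨n, rfl⟩
  have h3 : q.val * star b = star b := by
    rw [rightAnn_mul_eq]
    rintro _ ⟨n, rfl⟩
    have h4 := congrArg star (h1 n)
    rw [h2] at h4
    simpa [hps] using h4
  have h4 : b * q.val = 0 := hb _ <| by
    rw [mem_partialSumIdeal]
    refine Filter.Eventually.of_forall fun M => ?_
    rw [Finset.sum_mul]
    exact Finset.sum_eq_zero fun n _ => hq n
  have h5 := congrArg star h3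
  rw [star_mul, star_star, star_val, h4] at h5
  exact h5.symm

/-- If right ideals with zero left annihilator are essential, the algebra is finite. -/
theorem mul_star_eq_one_of_isAlgEssential (hAW : IsAWStar A)
    (h : ∀ I : Submodule ℂ A, IsRightIdeal I →
      (∀ b : A, (∀ x ∈ I, b * x = 0) → b = 0) → IsAlgEssential I)
    (hx : star x * x = 1) : x * star x = 1 := by
  let K : Submodule ℂ A := (LinearMap.mulLeft ℂ (x * star x)).ker
  have hmem : ∀ {a : A}, a ∈ K ↔ x * star x * a = 0 := LinearMap.mem_ker
  have hK : IsRightIdeal K := fun a ha b => by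
    rw [hmem] at ha ⊢
    rw [← mul_assoc, ha, zero_mul]
  have hp : 1 - x * star x ∈ K := by
    rw [hmem, mul_sub, mul_one, mul_assoc x, ← mul_assoc (star x), hx, one_mul, sub_self]
  by_contra hne
  have hK0 : K ≠ ⊥ := K.ne_bot_iff.2 ⟨_, hp, fun h0 => hne (sub_eq_zero.1 h0).symm⟩
  refine h _ isRightIdeal_partialSumIdeal
    (fun b hb => eq_zero_of_mul_partialSumIdeal_eq_zero hAW hx hb) K hK hK0 ?_
  rw [eq_bot_iff]
  rintro a ⟨haI, haK⟩
  exact eq_zero_of_mem_partialSumIdeal hx haI (by rw [sub_mul, hmem.1 haK, one_mul, sub_zero])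

end Isometry

end AWStar

theorem stmt13 (hAW : IsAWStar A) :
    (∀ x : A, star x * x = 1 → x * star x = 1) ↔
    (∀ I : Submodule ℂ A, IsRightIdeal I →
      (∀ b : A, (∀ x ∈ I, b * x = 0) → b = 0) → IsAlgEssential I) :=
  ⟨fun hfin _ hI hann => AWStar.isAlgEssential_of_finite hAW hfin hI hann,
    fun h _ hx => AWStar.mul_star_eq_one_of_isAlgEssential hAW h hx⟩
end

section
/- Let I be an essential closed two-sided ideal of A = C(X, B(H)). Then there exists an open dense subset U ⊆ X such that every f ∈ A satisfying f(t) ∈ K(H) for all t ∈ X and f(t) = 0 for all t ∈ X ∖ U belongs to I. -/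
open ContinuousMap

variable {X : Type*} [TopologicalSpace X] [CompactSpace X] [T2Space X]
variable {H : Type*} [NormedAddCommGroup H] [InnerProductSpace ℂ H] [CompleteSpace H]

/-- A submodule of `C(X, B(H))` is a two-sided ideal if it is closed under left and right
multiplication by arbitrary elements. -/
def IsTwoSidedIdealCM (I : Submodule ℂ C(X, H →L[ℂ] H)) : Prop :=
  ∀ f ∈ I, ∀ g : C(X, H →L[ℂ] H), f * g ∈ I ∧ g * f ∈ I

/-- A closed two-sided ideal is essential if it has nonzero intersection with every nonzero
closed two-sided ideal. -/
def IsEssentialTwoSided (I : Submodule ℂ C(X, H →L[ℂ] H)) : Prop :=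
  ∀ J : Submodule ℂ C(X, H →L[ℂ] H), IsTwoSidedIdealCM J →
    IsClosed (J : Set C(X, H →L[ℂ] H)) → J ≠ ⊥ → I ⊓ J ≠ ⊥

open InnerProductSpace in
/-- A nonzero two-sided ideal of bounded operators contains every projection onto a
finite-dimensional subspace. -/
theorem starProjection_mem_of_ne_zero {E : Type*} [NormedAddCommGroup E]
    [InnerProductSpace ℂ E] (L : Submodule ℂ (E →L[ℂ] E))
    (hL : ∀ T ∈ L, ∀ S : E →L[ℂ] E, T * S ∈ L ∧ S * T ∈ L)
    {T : E →L[ℂ] E} (hT : T ∈ L) (hT0 : T ≠ 0)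
    (F : Submodule ℂ E) [FiniteDimensional ℂ F] : F.starProjection ∈ L := by
  obtain ⟨v, hv⟩ : ∃ v, T v ≠ 0 := by
    by_contra! h
    exact hT0 (ContinuousLinearMap.ext h)
  have rankOne_mem (x y : E) : rankOne ℂ x y ∈ L := by
    have hc : inner ℂ (T v) (T v) ≠ 0 := inner_self_ne_zero.mpr hv
    have h := L.smul_mem (inner ℂ (T v) (T v))⁻¹
      (hL _ (hL T hT (rankOne ℂ v y)).1 (rankOne ℂ x (T v))).2
    convert h using 1
    ext z
    simp only [rankOne_apply, _root_.smul_apply, mul_apply_eq_comp, map_smul, smul_smul]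
    congr 1
    field_simp
  rw [(stdOrthonormalBasis ℂ F).starProjection_eq_sum_rankOne]
  exact L.sum_mem fun i _ => rankOne_mem _ _

/-- Compact operators on a Hilbert space are approximated by their compressions to
finite-dimensional subspaces. -/
theorem IsCompactOperator.exists_norm_starProjection_mul_sub_lt {E : Type*}
    [NormedAddCommGroup E] [InnerProductSpace ℂ E] {T : E →L[ℂ] E}
    (hT : IsCompactOperator T) {ε : ℝ} (hε : 0 < ε) :
    ∃ (F : Submodule ℂ E) (_ : FiniteDimensional ℂ F), ‖F.starProjection * T - T‖ < ε := by
  obtain ⟨K, hK, hTK⟩ := IsCompactOperator.image_closedBall_subset_compact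
    (f := (T : E →ₗ[ℂ] E)) hT 1
  obtain ⟨s, hs, hKs⟩ := Metric.totallyBounded_iff.mp hK.totallyBounded (ε / 2) (half_pos hε)
  have : FiniteDimensional ℂ (Submodule.span ℂ s) := FiniteDimensional.span_of_finite ℂ hs
  refine ⟨Submodule.span ℂ s, this, lt_of_le_of_lt ?_ (half_lt_self hε)⟩
  refine ContinuousLinearMap.opNorm_le_of_unit_norm (half_pos hε).le fun x hx => ?_
  have hxK : T x ∈ K := hTK ⟨x, by simp [hx], rfl⟩
  obtain ⟨y, hy, hxy⟩ := Set.mem_iUnion₂.mp (hKs hxK)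
  rw [_root_.sub_apply, mul_apply_eq_comp, norm_sub_rev,
    Submodule.starProjection_minimal]
  refine (ciInf_le ⟨0, ?_⟩ (⟨y, Submodule.subset_span hy⟩ : Submodule.span ℂ s)).trans ?_
  · rintro _ ⟨z, rfl⟩
    exact norm_nonneg _
  · rw [← dist_eq_norm]
    exact (Metric.mem_ball.mp hxy).le

/-- The scalar operator-valued function attached to a real-valued continuous function. -/
noncomputable def scalarFun (H : Type*) [NormedAddCommGroup H] [InnerProductSpace ℂ H]
    {X : Type*} [TopologicalSpace X] (φ : C(X, ℝ)) : C(X, H →L[ℂ] H) :=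
  ⟨fun x => (φ x : ℂ) • 1, by fun_prop⟩

/-- A closed two-sided ideal of `C(X, B(H))` contains every function that it approximates
pointwise. -/
theorem mem_of_forall_exists_norm_sub_lt {I : Submodule ℂ C(X, H →L[ℂ] H)}
    (h2 : IsTwoSidedIdealCM I) (hc : IsClosed (I : Set C(X, H →L[ℂ] H)))
    {f : C(X, H →L[ℂ] H)} (hf : ∀ t, ∀ ε > 0, ∃ g ∈ I, ‖g t - f t‖ < ε) : f ∈ I := by
  rw [← SetLike.mem_coe, ← hc.closure_eq, Metric.mem_closure_iff]
  intro ε hε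
  choose g hgI hg using fun t => hf t (ε / 2) (half_pos hε)
  let O : X → Set X := fun t => {s | ‖g t s - f s‖ < ε / 2}
  have hO (t : X) : IsOpen (O t) := isOpen_lt (by fun_prop) continuous_const
  obtain ⟨S, hS⟩ := isCompact_univ.elim_finite_subcover O hO
    fun t _ => Set.mem_iUnion.mpr ⟨t, hg t⟩
  obtain ⟨φ, hφ⟩ := PartitionOfUnity.exists_isSubordinate isClosed_univ
    (fun i : S => O i) (fun i => hO i) (by simpa [Set.iUnion_subtype] using hS)
  refine ⟨∑ i : S, scalarFun H (φ i) * g i, I.sum_mem fun i _ => (h2 _ (hgI i) _).2, ?_⟩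
  rw [dist_comm, dist_eq_norm]
  refine lt_of_le_of_lt ((ContinuousMap.norm_le _ (half_pos hε).le).mpr fun x => ?_)
    (half_lt_self hε)
  have hsum : ∑ i : S, φ i x = 1 := by
    rw [← finsum_eq_sum_of_fintype]
    exact φ.sum_eq_one (Set.mem_univ x)
  have hdiff : (∑ i : S, scalarFun H (φ i) * g i - f) x
      = ∑ i : S, (φ i x : ℂ) • (g i x - f x) := by
    simp only [smul_sub, Finset.sum_sub_distrib, ← Finset.sum_smul, ← Complex.ofReal_sum, hsum]
    simp [scalarFun, ContinuousMap.sum_apply]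
  rw [hdiff]
  calc ‖∑ i : S, (φ i x : ℂ) • (g i x - f x)‖
      ≤ ∑ i : S, φ i x * (ε / 2) := norm_sum_le_of_le _ fun i _ => by
        rw [norm_smul, Complex.norm_real, Real.norm_of_nonneg (φ.nonneg i x)]
        by_cases hx : φ i x = 0
        · simp [hx]
        · have hxO : x ∈ O i := hφ i (subset_tsupport _ hx)
          exact mul_le_mul_of_nonneg_left (le_of_lt hxO) (φ.nonneg i x)
    _ = ε / 2 := by rw [← Finset.sum_mul, hsum, one_mul]

/-- The functions in an essential ideal do not all vanish on a nonempty open set. -/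
theorem IsEssentialTwoSided.dense_setOf_exists_ne_zero [Nontrivial H]
    {I : Submodule ℂ C(X, H →L[ℂ] H)} (he : IsEssentialTwoSided I) :
    Dense {t : X | ∃ f ∈ I, f t ≠ 0} := by
  rw [dense_iff_inter_open]
  rintro V hV ⟨t, htV⟩
  let J : Submodule ℂ C(X, H →L[ℂ] H) :=
    { carrier := {f | ∀ x ∉ V, f x = 0}
      add_mem' := fun ha hb x hx => by simp [ha x hx, hb x hx]
      zero_mem' := fun x _ => rfl
      smul_mem' := fun c a ha x hx => by simp [ha x hx] }
  have hJ2 : IsTwoSidedIdealCM J := fun f hf g =>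
    ⟨fun x hx => by simp [hf x hx], fun x hx => by simp [hf x hx]⟩
  have hJc : IsClosed (J : Set C(X, H →L[ℂ] H)) := by
    have : (J : Set C(X, H →L[ℂ] H)) = ⋂ x ∈ Vᶜ, {f | f x = 0} := by
      ext f
      simp only [Set.mem_iInter₂]
      rfl
    rw [this]
    exact isClosed_biInter fun x _ =>
      isClosed_eq (continuous_eval_const x) continuous_const
  have hJ0 : J ≠ ⊥ := by
    obtain ⟨φ, h0, h1, -⟩ := exists_continuous_zero_one_of_isClosed hV.isClosed_compl
      (isClosed_singleton (x := t)) (Set.disjoint_singleton_right.mpr fun h => h htV)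
    refine J.ne_bot_iff.mpr ⟨scalarFun H φ, fun x hx => ?_, fun h => ?_⟩
    · simp [scalarFun, h0 hx]
    · have := DFunLike.congr_fun h t
      simp [scalarFun, h1 rfl] at this
  obtain ⟨f, ⟨hfI, hfJ⟩, hf0⟩ := (Submodule.ne_bot_iff _).mp (he J hJ2 hJc hJ0)
  obtain ⟨x, hx⟩ : ∃ x, f x ≠ 0 := by
    by_contra! h
    exact hf0 (ContinuousMap.ext h)
  exact ⟨x, by_contra fun hxV => hx (hfJ x hxV), f, hfI, hx⟩

theorem stmt14 (hdim : ¬ FiniteDimensional ℂ H)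
    (I : Submodule ℂ C(X, H →L[ℂ] H)) (h2 : IsTwoSidedIdealCM I)
    (hc : IsClosed (I : Set C(X, H →L[ℂ] H))) (he : IsEssentialTwoSided I) :
    ∃ U : Set X, IsOpen U ∧ Dense U ∧
      ∀ f : C(X, H →L[ℂ] H), (∀ t : X, IsCompactOperator (f t)) →
        (∀ t : X, t ∉ U → f t = 0) → f ∈ I := by
  have : Nontrivial H := by
    by_contra h
    rw [not_nontrivial_iff_subsingleton] at h
    exact hdim inferInstance
  refine ⟨{t | ∃ g ∈ I, g t ≠ 0}, ?_, he.dense_setOf_exists_ne_zero, fun f hf hfU => ?_⟩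
  · have : {t : X | ∃ g ∈ I, g t ≠ 0} = ⋃ g ∈ I, {t | g t ≠ 0} := by
      ext t
      simp
    rw [this]
    exact isOpen_biUnion fun g _ => isOpen_ne_fun g.continuous continuous_const
  refine mem_of_forall_exists_norm_sub_lt h2 hc fun t ε hε => ?_
  by_cases ht : ∃ g ∈ I, g t ≠ 0
  · obtain ⟨g, hgI, hgt⟩ := ht
    obtain ⟨F, _, hF⟩ := (hf t).exists_norm_starProjection_mul_sub_lt hε
    obtain ⟨p, hpI, hp⟩ := starProjection_mem_of_ne_zero
      (I.map (ContinuousMap.evalCLM ℂ t : C(X, H →L[ℂ] H) →L[ℂ] H →L[ℂ] H).toLinearMap)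
      (by
        rintro _ ⟨a, ha, rfl⟩ S
        exact ⟨⟨a * .const X S, (h2 a ha _).1, rfl⟩, ⟨.const X S * a, (h2 a ha _).2, rfl⟩⟩) ⟨g, hgI, rfl⟩ hgt F
    refine ⟨p * f, (h2 p hpI f).1, ?_⟩
    have hp' : p t = F.starProjection := hp
    rwa [ContinuousMap.mul_apply, hp']
  · exact ⟨0, I.zero_mem, by simpa [hfU t ht] using hε⟩
end

section
/- Let I be an algebraically essential closed right ideal of A = C(X, B(H)) and let ξ ∈ H be a unit vector. Then there exists an open dense subset U ⊆ X such that for every continuous function g : X → ℂ vanishing on X ∖ U and every h ∈ A, the function t ↦ g(t)·e_ξ·h(t) belongs to I. -/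
open ContinuousMap

variable {X : Type*} [TopologicalSpace X] [CompactSpace X] [T2Space X]
variable {H : Type*} [NormedAddCommGroup H] [InnerProductSpace ℂ H] [CompleteSpace H]

/-- A submodule of `C(X, B(H))` is a right ideal if it is closed under right multiplication
by arbitrary elements. -/
def IsRightIdealCM (I : Submodule ℂ C(X, H →L[ℂ] H)) : Prop :=
  ∀ f ∈ I, ∀ g : C(X, H →L[ℂ] H), f * g ∈ I

/-- A right ideal is algebraically essential if it has nonzero intersection with every
nonzero right ideal. -/
def IsAlgEssentialCM (I : Submodule ℂ C(X, H →L[ℂ] H)) : Prop :=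
  ∀ K : Submodule ℂ C(X, H →L[ℂ] H), IsRightIdealCM K → K ≠ ⊥ → I ⊓ K ≠ ⊥

/-- The orthogonal projection `e_ξ` onto the one-dimensional subspace spanned by the
unit vector `ξ`, given by `v ↦ ⟨v, ξ⟩ ξ`. -/
noncomputable def eProj (ξ : H) : H →L[ℂ] H :=
  (innerSL ℂ ξ).smulRight ξ

omit [CompleteSpace H] in
theorem eProj_apply (ξ v : H) : eProj ξ v = inner ℂ ξ v • ξ := rfl

theorem star_eProj (ξ : H) : star (eProj ξ) = eProj ξ := by
  rw [ContinuousLinearMap.star_eq_adjoint, eq_comm, ContinuousLinearMap.eq_adjoint_iff]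
  intro x y
  simp only [eProj_apply, inner_smul_left, inner_smul_right, inner_conj_symm]
  ring

omit [CompleteSpace H] in
theorem eProj_mul_self {ξ : H} (hξ : ‖ξ‖ = 1) : eProj ξ * eProj ξ = eProj ξ := by
  ext v
  simp [eProj_apply, inner_self_eq_norm_sq_to_K, hξ]

omit [CompleteSpace H] in
theorem eProj_mul_mul_eProj (ξ : H) (T : H →L[ℂ] H) :
    eProj ξ * T * eProj ξ = inner ℂ ξ (T ξ) • eProj ξ := by
  ext v
  simp [eProj_apply, smul_smul, mul_comm]

/-- The function `t ↦ g t • e_ξ`. -/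
noncomputable def smulEProj (ξ : H) (g : C(X, ℂ)) : C(X, H →L[ℂ] H) :=
  ⟨fun t => g t • eProj ξ, by fun_prop⟩

omit [CompactSpace X] [T2Space X] [CompleteSpace H] in
theorem smulEProj_apply (ξ : H) (g : C(X, ℂ)) (t : X) :
    smulEProj ξ g t = g t • eProj ξ := rfl

omit [CompactSpace X] [T2Space X] [CompleteSpace H] in
theorem continuous_smulEProj (ξ : H) :
    Continuous (smulEProj ξ : C(X, ℂ) → C(X, H →L[ℂ] H)) := by
  have h : Continuous fun z : ℂ => z • eProj ξ := by fun_prop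
  exact ContinuousMap.continuous_postcomp ⟨_, h⟩

/-- The scalar functions `g` for which `t ↦ g t • e_ξ` lies in a given right ideal. -/
noncomputable def scalarIdeal (I : Submodule ℂ C(X, H →L[ℂ] H)) (hI : IsRightIdealCM I) (ξ : H) :
    Ideal C(X, ℂ) where
  carrier := {g | smulEProj ξ g ∈ I}
  zero_mem' := by
    have h : smulEProj ξ (0 : C(X, ℂ)) = 0 := by ext t; simp [smulEProj_apply]
    simp [h]
  add_mem' {a b} ha hb := by
    have h : smulEProj ξ (a + b) = smulEProj ξ a + smulEProj ξ b := by
      ext t; simp [smulEProj_apply, add_smul]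
    simpa [h] using I.add_mem ha hb
  smul_mem' c g hg := by
    have h : smulEProj ξ (c • g) =
        smulEProj ξ g * ⟨fun t => c t • (1 : H →L[ℂ] H), by fun_prop⟩ := by
      ext t v
      simp [smulEProj_apply, smul_smul]
    change smulEProj ξ (c • g) ∈ I
    exact h ▸ hI _ hg _

omit [T2Space X] in
theorem exists_mem_scalarIdeal_ne_zero {I : Submodule ℂ C(X, H →L[ℂ] H)}
    (hI : IsRightIdealCM I) (hIe : IsAlgEssentialCM I) {ξ : H} (hξ : ‖ξ‖ = 1)
    {φ : C(X, ℂ)} (hφ : φ ≠ 0) :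
    ∃ g ∈ scalarIdeal I hI ξ, ∃ t, g t ≠ 0 ∧ φ t ≠ 0 := by
  have hξ0 : eProj ξ ≠ 0 := by
    intro h
    have h1 := congrArg (fun T : H →L[ℂ] H => T ξ) h
    have h2 : ξ = 0 := by
      simpa [eProj_apply, inner_self_eq_norm_sq_to_K, hξ] using h1
    simp [h2] at hξ
  obtain ⟨s, hs⟩ := DFunLike.ne_iff.mp hφ
  let K := LinearMap.range (LinearMap.mulLeft ℂ (smulEProj ξ φ))
  have hK : IsRightIdealCM K := by
    rintro _ ⟨k, rfl⟩ g
    exact ⟨k * g, by simp [mul_assoc]⟩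
  have hK0 : K ≠ ⊥ := by
    refine (Submodule.ne_bot_iff _).mpr ⟨smulEProj ξ φ, ⟨1, by simp⟩, fun h => ?_⟩
    exact smul_ne_zero hs hξ0 (DFunLike.congr_fun h s)
  obtain ⟨f, ⟨hfI, k, hk⟩, hf0⟩ := (Submodule.ne_bot_iff _).mp (hIe K hK hK0)
  obtain ⟨t, ht⟩ := DFunLike.ne_iff.mp hf0
  have hfk (x : X) : f x = φ x • (eProj ξ * k x) := by
    rw [← hk]
    simp [smulEProj_apply]
  have hef (x : X) : eProj ξ * f x = f x := by
    rw [hfk, mul_smul_comm, ← mul_assoc, eProj_mul_self hξ]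
  have hfe (x : X) : star (f x) * eProj ξ = star (f x) := by
    conv_rhs => rw [← hef x, star_mul, star_eProj]
  let g : C(X, ℂ) := ⟨fun x => inner ℂ ξ ((f * star f) x ξ), by fun_prop⟩
  have hg : smulEProj ξ g = f * star f := by
    ext1 x
    change inner ℂ ξ ((f x * star (f x)) ξ) • eProj ξ = f x * star (f x)
    rw [← eProj_mul_mul_eProj, ← mul_assoc, hef, mul_assoc, hfe]
  refine ⟨g, show smulEProj ξ g ∈ I from hg ▸ hI f hfI _, t, fun h => ?_, fun h => ?_⟩
  · have h1 : f t * star (f t) = 0 := by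
      have := DFunLike.congr_fun hg t
      rw [smulEProj_apply, h, zero_smul] at this
      exact this.symm
    exact ht (CStarRing.mul_star_self_eq_zero_iff _ |>.mp h1)
  · exact ht (by simp [hfk, h])

theorem dense_setOfIdeal_scalarIdeal {I : Submodule ℂ C(X, H →L[ℂ] H)}
    (hI : IsRightIdealCM I) (hIe : IsAlgEssentialCM I) {ξ : H} (hξ : ‖ξ‖ = 1) :
    Dense (setOfIdeal (scalarIdeal I hI ξ)) := by
  refine dense_iff_inter_open.mpr fun V hV ⟨x, hx⟩ => ?_
  obtain ⟨u, hu0, hu1, -⟩ := exists_continuous_zero_one_of_isClosed hV.isClosed_compl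
    (isClosed_singleton (x := x)) (by simpa using hx)
  let φ : C(X, ℂ) := ⟨fun t => (u t : ℂ), by fun_prop⟩
  have hφ : φ ≠ 0 := by
    refine DFunLike.ne_iff.mpr ⟨x, ?_⟩
    simp [φ, hu1 rfl]
  obtain ⟨g, hg, t, hgt, hφt⟩ := exists_mem_scalarIdeal_ne_zero hI hIe hξ hφ
  refine ⟨t, ?_, mem_setOfIdeal.mpr ⟨g, hg, hgt⟩⟩
  by_contra htV
  exact hφt (by simp [φ, hu0 htV])

theorem stmt15 (hdim : ¬ FiniteDimensional ℂ H)
    (I : Submodule ℂ C(X, H →L[ℂ] H)) (hIr : IsRightIdealCM I)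
    (hIc : IsClosed (I : Set C(X, H →L[ℂ] H))) (hIe : IsAlgEssentialCM I)
    (ξ : H) (hξ : ‖ξ‖ = 1) :
    ∃ U : Set X, IsOpen U ∧ Dense U ∧
      ∀ g : C(X, ℂ), (∀ t : X, t ∉ U → g t = 0) →
        ∀ h F : C(X, H →L[ℂ] H), (∀ t : X, F t = g t • (eProj ξ * h t)) → F ∈ I := by
  refine ⟨setOfIdeal (scalarIdeal I hIr ξ), setOfIdeal_open _,
    dense_setOfIdeal_scalarIdeal hIr hIe hξ, fun g hg h F hF => ?_⟩
  have hclosed : IsClosed (scalarIdeal I hIr ξ : Set C(X, ℂ)) :=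
    hIc.preimage (continuous_smulEProj ξ)
  have hgI : g ∈ scalarIdeal I hIr ξ := by
    rw [← idealOfSet_ofIdeal_isClosed hclosed]
    exact mem_idealOfSet.mpr fun t ht => hg t ht
  have hFg : F = smulEProj ξ g * h := by
    ext1 t
    rw [hF, mul_apply, smulEProj_apply, smul_mul_assoc]
  exact hFg ▸ hIr _ hgI h
end

section
/- Suppose in addition that every meagre subset of X is nowhere dense and that H is separable. Then every algebraically essential closed right ideal I of A = C(X, B(H)) contains an essential closed two-sided ideal of A; more precisely, there exists an open dense subset V ⊆ X such that every f ∈ A satisfying f(t) ∈ K(H) for all t ∈ X and f(t) = 0 for all t ∈ X ∖ V belongs to I. -/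
open ContinuousMap

variable {X : Type*} [TopologicalSpace X] [CompactSpace X] [T2Space X]
variable {H : Type*} [NormedAddCommGroup H] [InnerProductSpace ℂ H] [CompleteSpace H]

open InnerProductSpace

/-- A closed right ideal of `B(H)` containing the rank one operators `rankOne ℂ ξ η` for `ξ` in a
dense set and all `η` contains every compact operator. -/
theorem mem_of_isCompactOperator_of_rankOne_mem (L : Submodule ℂ (H →L[ℂ] H))
    (hLc : IsClosed (L : Set (H →L[ℂ] H))) (hLr : ∀ T ∈ L, ∀ S : H →L[ℂ] H, T * S ∈ L)
    {D : Set H} (hD : Dense D) (hDL : ∀ ξ ∈ D, ∀ η, rankOne ℂ ξ η ∈ L)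
    {T : H →L[ℂ] H} (hT : IsCompactOperator T) : T ∈ L := by
  have hall (ξ η : H) : rankOne ℂ ξ η ∈ L := by
    have hcl : IsClosed {ξ : H | rankOne ℂ ξ η ∈ L} :=
      hLc.preimage (f := fun ξ : H ↦ (rankOne ℂ ξ η : H →L[ℂ] H)) (by fun_prop)
    have hsub : D ⊆ {ξ : H | rankOne ℂ ξ η ∈ L} := fun ξ hξ ↦ hDL ξ hξ η
    exact (hcl.closure_subset_iff.2 hsub) (hD ξ)
  rw [← SetLike.mem_coe, ← hLc.closure_eq, Metric.mem_closure_iff]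
  intro ε hε
  have htb : TotallyBounded (T '' Metric.closedBall 0 1) :=
    (IsCompactOperator.isCompact_closure_image_closedBall (f := T.toLinearMap) hT 1
      ).totallyBounded.subset subset_closure
  obtain ⟨F, hF, hcov⟩ := Metric.totallyBounded_iff.1 htb (ε / 2) (half_pos hε)
  let U := Submodule.span ℂ F
  have : FiniteDimensional ℂ U := FiniteDimensional.span_of_finite ℂ hF
  refine ⟨U.starProjection * T, ?_, ?_⟩
  · refine hLr _ ?_ T
    rw [(stdOrthonormalBasis ℂ U).starProjection_eq_sum_rankOne]
    exact L.sum_mem fun i _ ↦ hall _ _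
  · rw [dist_eq_norm]
    refine lt_of_le_of_lt (ContinuousLinearMap.opNorm_le_of_unit_norm (half_pos hε).le
      fun x hx ↦ ?_) (half_lt_self hε)
    have hmem : T x ∈ T '' Metric.closedBall 0 1 := ⟨x, by simp [hx], rfl⟩
    obtain ⟨c, hc, hxc⟩ := Set.mem_iUnion₂.1 (hcov hmem)
    have hmin : ‖T x - U.starProjection (T x)‖ ≤ ‖T x - c‖ := by
      rw [Submodule.starProjection_minimal]
      exact ciInf_le ⟨0, by rintro _ ⟨y, rfl⟩; positivity⟩
        (⟨c, Submodule.subset_span hc⟩ : U)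
    rw [Metric.mem_ball, dist_eq_norm] at hxc
    exact hmin.trans hxc.le

/-- A right ideal of `C(X, B(H))` is a `C(X, ℝ)`-submodule. -/
theorem IsRightIdealCM.smul_mem {I : Submodule ℂ C(X, H →L[ℂ] H)} (hI : IsRightIdealCM I)
    (ρ : C(X, ℝ)) {f : C(X, H →L[ℂ] H)} (hf : f ∈ I) : ρ • f ∈ I := by
  have h : ρ • f = f * (ρ • (1 : C(X, H →L[ℂ] H))) := by
    ext x v
    simp
  rw [h]
  exact hI f hf _

/-- An element of `C(X, B(H))` that is pointwise in the closure of the fibres of a closed right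
ideal belongs to this ideal. -/
theorem IsRightIdealCM.mem_of_forall_apply_mem_closure {I : Submodule ℂ C(X, H →L[ℂ] H)}
    (hI : IsRightIdealCM I) (hIc : IsClosed (I : Set C(X, H →L[ℂ] H))) {f : C(X, H →L[ℂ] H)}
    (hf : ∀ t, ∀ ε > 0, ∃ h ∈ I, ‖f t - h t‖ < ε) : f ∈ I := by
  rw [← SetLike.mem_coe, ← hIc.closure_eq, Metric.mem_closure_iff]
  intro ε hε
  choose h hhI hh using fun t ↦ hf t (ε / 2) (half_pos hε)
  let U : X → Set X := fun t ↦ {x | ‖f x - h t x‖ < ε / 2}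
  have hU (t : X) : IsOpen (U t) := isOpen_lt (by fun_prop) continuous_const
  obtain ⟨s, hs⟩ := isCompact_univ.elim_finite_subcover U hU
    fun t _ ↦ Set.mem_iUnion.2 ⟨t, hh t⟩
  obtain ⟨ρ, hρ⟩ := PartitionOfUnity.exists_isSubordinate isClosed_univ (fun i : s ↦ U i)
    (fun i ↦ hU i) (by simpa [Set.iUnion_subtype] using hs)
  refine ⟨∑ i, ρ i • h i, I.sum_mem fun i _ ↦ hI.smul_mem _ (hhI i), ?_⟩
  rw [dist_eq_norm]
  refine lt_of_le_of_lt ((ContinuousMap.norm_le _ (half_pos hε).le).2 fun x ↦ ?_)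
    (half_lt_self hε)
  have hsum : ∑ i, ρ i x = 1 := by
    rw [← finsum_eq_sum_of_fintype]
    exact ρ.sum_eq_one (Set.mem_univ x)
  have hdiff : (f - ∑ i, ρ i • h i) x = ∑ i, ρ i x • (f x - h i x) := by
    simp only [smul_sub, Finset.sum_sub_distrib, ← Finset.sum_smul, hsum, one_smul]
    simp
  rw [hdiff]
  calc ‖∑ i, ρ i x • (f x - h i x)‖ ≤ ∑ i, ρ i x * (ε / 2) := by
        refine norm_sum_le_of_le _ fun i _ ↦ ?_
        rw [norm_smul, Real.norm_of_nonneg (ρ.nonneg i x)]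
        by_cases hx : ρ i x = 0
        · simp [hx]
        · have hxU : x ∈ U i := hρ i (subset_tsupport _ hx)
          exact mul_le_mul_of_nonneg_left (le_of_lt hxU) (ρ.nonneg i x)
    _ = ε / 2 := by rw [← Finset.sum_mul, hsum, one_mul]

/-- Urysohn's lemma for a point and an open neighbourhood of it. -/
theorem exists_continuousMap_eq_one_of_mem_isOpen {U : Set X} (hU : IsOpen U) {t : X}
    (ht : t ∈ U) : ∃ φ : C(X, ℝ), φ t = 1 ∧ ∀ s ∉ U, φ s = 0 := by
  obtain ⟨φ, h0, h1, -⟩ := exists_continuous_zero_one_of_isClosed hU.isClosed_compl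
    (isClosed_singleton (x := t)) (by simpa using ht)
  exact ⟨φ, h1 rfl, fun s hs ↦ h0 hs⟩

/-- For every vector `ξ`, the fibres of an algebraically essential right ideal contain all rank one
operators with range `ℂ ξ` over an open dense set. -/
theorem IsAlgEssentialCM.exists_isOpen_dense_rankOne {I : Submodule ℂ C(X, H →L[ℂ] H)}
    (hIr : IsRightIdealCM I) (hIe : IsAlgEssentialCM I) (ξ : H) :
    ∃ U : Set X, IsOpen U ∧ Dense U ∧ ∀ s ∈ U, ∀ η, ∃ h ∈ I, h s = rankOne ℂ ξ η := by
  by_cases hξ : ξ = 0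
  · exact ⟨Set.univ, isOpen_univ, dense_univ, fun s _ η ↦ ⟨0, I.zero_mem, by simp [hξ]⟩⟩
  let p : C(X, H →L[ℂ] H) := ContinuousMap.const X (rankOne ℂ ξ ξ)
  refine ⟨⋃ a ∈ {a : C(X, H →L[ℂ] H) | p * a ∈ I}, {s | (p * a) s ≠ 0},
    isOpen_biUnion fun a _ ↦ isOpen_ne_fun (by fun_prop) continuous_const, ?_, ?_⟩
  · rw [dense_iff_inter_open]
    rintro W hW ⟨t, ht⟩
    obtain ⟨φ, hφt, hφ⟩ := exists_continuousMap_eq_one_of_mem_isOpen hW ht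
    have hK := hIe (LinearMap.range (LinearMap.mulLeft ℂ (φ • p))) (by
      rintro _ ⟨a, rfl⟩ g
      exact ⟨a * g, by simp [mul_assoc]⟩) (by
      intro hbot
      have hmem : φ • p ∈ LinearMap.range (LinearMap.mulLeft ℂ (φ • p)) := ⟨1, by simp⟩
      rw [hbot, Submodule.mem_bot] at hmem
      have := congrArg (fun g : C(X, H →L[ℂ] H) ↦ g t) hmem
      simp [hφt, p, hξ] at this)
    obtain ⟨_, ⟨hgI, ⟨a, rfl⟩⟩, hg⟩ := (Submodule.ne_bot_iff _).1 hK
    obtain ⟨s, hs⟩ := DFunLike.ne_iff.1 hg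
    have hcomm : LinearMap.mulLeft ℂ (φ • p) a = p * (φ • a) := by
      ext x v
      simp
    refine ⟨s, ?_, Set.mem_iUnion₂.2 ⟨φ • a, ?_, ?_⟩⟩
    · by_contra hsW
      exact hs (by simp [hφ s hsW])
    · exact Set.mem_ofPred.2 (hcomm ▸ hgI)
    · exact hcomm ▸ hs
  · intro s hs η
    obtain ⟨a, ha, hsa⟩ := Set.mem_iUnion₂.1 hs
    let ζ := ContinuousLinearMap.adjoint (a s) ξ
    have hpa : (p * a) s = rankOne ℂ ξ ζ := by
      ext v
      simp [p, ζ, ContinuousLinearMap.adjoint_inner_left]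
    have hζ : ζ ≠ 0 := by
      intro h0
      exact hsa (by rw [hpa, h0]; simp)
    refine ⟨p * a * ContinuousMap.const X ((inner ℂ ζ ζ)⁻¹ • rankOne ℂ ζ η), hIr _ ha _, ?_⟩
    rw [ContinuousMap.mul_apply, hpa]
    ext v
    have : inner ℂ ζ ζ ≠ 0 := inner_self_ne_zero.2 hζ
    simp only [ContinuousMap.const_apply, mul_smul_comm, ContinuousLinearMap.mul_def,
      rankOne_comp_rankOne, inv_smul_smul₀ this]

/-- The functions in `C(X, B(H))` with compact values that vanish off `V`. -/
def compactVanishingOff (X H : Type*) [TopologicalSpace X]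
    [NormedAddCommGroup H] [InnerProductSpace ℂ H] (V : Set X) : Submodule ℂ C(X, H →L[ℂ] H) where
  carrier := {f | (∀ t, IsCompactOperator (f t)) ∧ ∀ t, t ∉ V → f t = 0}
  add_mem' hf hg := ⟨fun t ↦ (hf.1 t).add (hg.1 t),
    fun t ht ↦ by simp [hf.2 t ht, hg.2 t ht]⟩
  zero_mem' := ⟨fun _ ↦ isCompactOperator_zero, fun _ _ ↦ rfl⟩
  smul_mem' c _ hf := ⟨fun t ↦ (hf.1 t).smul c, fun t ht ↦ by simp [hf.2 t ht]⟩

theorem isTwoSidedIdealCM_compactVanishingOff (V : Set X) :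
    IsTwoSidedIdealCM (compactVanishingOff X H V) := fun _ hf g ↦
  ⟨⟨fun t ↦ (hf.1 t).comp_clm (g t), fun t ht ↦ by simp [hf.2 t ht]⟩,
    ⟨fun t ↦ (hf.1 t).clm_comp (g t), fun t ht ↦ by simp [hf.2 t ht]⟩⟩

theorem isClosed_compactVanishingOff (V : Set X) :
    IsClosed (compactVanishingOff X H V : Set C(X, H →L[ℂ] H)) := by
  refine IsClosed.inter (s₁ := {f | ∀ t, IsCompactOperator (f t)})
    (s₂ := {f : C(X, H →L[ℂ] H) | ∀ t, t ∉ V → f t = 0}) ?_ ?_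
  · rw [Set.ofPred_forall]
    exact isClosed_iInter fun t ↦
      isClosed_setOfPred_isCompactOperator.preimage (continuous_eval_const t)
  · simp only [Set.ofPred_forall]
    exact isClosed_iInter fun t ↦ isClosed_iInter fun _ ↦
      isClosed_eq (continuous_eval_const t) continuous_const

theorem isEssentialTwoSided_compactVanishingOff {V : Set X} (hVo : IsOpen V) (hVd : Dense V) :
    IsEssentialTwoSided (compactVanishingOff X H V) := by
  intro J hJ _ hJ0
  obtain ⟨f, hfJ, hf⟩ := (Submodule.ne_bot_iff _).1 hJ0
  obtain ⟨t₀, ht₀⟩ := DFunLike.ne_iff.1 hf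
  have hopen : IsOpen {t | f t ≠ 0} := isOpen_ne_fun (by fun_prop) continuous_const
  obtain ⟨t, hft, htV⟩ := hVd.inter_open_nonempty _ hopen ⟨t₀, ht₀⟩
  obtain ⟨ξ, hξ⟩ := DFunLike.ne_iff.1 (show f t ≠ 0 from hft)
  obtain ⟨φ, hφt, hφ⟩ := exists_continuousMap_eq_one_of_mem_isOpen hVo htV
  have hξ0 : ξ ≠ 0 := by
    rintro rfl
    simp at hξ
  let g : C(X, H →L[ℂ] H) := φ • ContinuousMap.const X (rankOne ℂ ξ ξ)
  have hg : g ∈ compactVanishingOff X H V := by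
    refine ⟨fun s ↦ ?_, fun s hs ↦ by simp [g, hφ s hs]⟩
    have hrank : IsCompactOperator (rankOne ℂ ξ ξ : H →L[ℂ] H) := by
      rw [rankOne_def']
      exact (isCompactOperator_of_locallyCompactSpace_rng
        (ContinuousLinearMap.toSpanSingleton ℂ ξ)).comp_clm (innerSL ℂ ξ)
    exact hrank.smul (φ s)
  refine (Submodule.ne_bot_iff _).2 ⟨f * g,
    ⟨(isTwoSidedIdealCM_compactVanishingOff V g hg f).2, (hJ f hfJ g).1⟩, fun h0 ↦ ?_⟩
  have := congrArg (fun k : C(X, H →L[ℂ] H) ↦ k t ξ) h0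
  simp [g, hφt, hξ0] at this
  exact hξ this

/-- An algebraically essential closed right ideal contains all compact valued functions vanishing
off some open dense set. -/
theorem IsAlgEssentialCM.exists_compactVanishingOff_le [TopologicalSpace.SeparableSpace H]
    (hX : ∀ S : Set X, IsMeagre S → IsNowhereDense S)
    {I : Submodule ℂ C(X, H →L[ℂ] H)} (hIr : IsRightIdealCM I)
    (hIc : IsClosed (I : Set C(X, H →L[ℂ] H))) (hIe : IsAlgEssentialCM I) :
    ∃ V : Set X, IsOpen V ∧ Dense V ∧ compactVanishingOff X H V ≤ I := by
  choose U hUo hUd hU using fun n ↦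
    hIe.exists_isOpen_dense_rankOne hIr (TopologicalSpace.denseSeq H n)
  have hmeagre : IsMeagre (⋂ n, U n)ᶜ := by
    rw [IsMeagre, compl_compl]
    exact countable_iInter_mem.2 fun n ↦ residual_of_dense_open (hUo n) (hUd n)
  refine ⟨(closure (⋂ n, U n)ᶜ)ᶜ, isClosed_closure.isOpen_compl,
    interior_eq_empty_iff_dense_compl.1 (hX _ hmeagre), fun f hf ↦
    hIr.mem_of_forall_apply_mem_closure hIc fun t ε hε ↦ ?_⟩
  by_cases ht : t ∈ (closure (⋂ n, U n)ᶜ)ᶜ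
  · have htU (n : ℕ) : t ∈ U n := by
      have : t ∈ ⋂ n, U n := by
        by_contra h
        exact ht (subset_closure h)
      exact Set.mem_iInter.1 this n
    let ev : C(X, H →L[ℂ] H) →ₗ[ℂ] (H →L[ℂ] H) :=
      { toFun := fun h ↦ h t, map_add' := fun _ _ ↦ rfl, map_smul' := fun _ _ ↦ rfl }
    have hmem : f t ∈ (I.map ev).topologicalClosure := by
      refine mem_of_isCompactOperator_of_rankOne_mem _ (Submodule.isClosed_topologicalClosure _)
        (fun T hT S ↦ ?_) (TopologicalSpace.denseRange_denseSeq H) ?_ (hf.1 t)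
      · refine map_mem_closure (f := fun T ↦ T * S) (by fun_prop) hT ?_
        rintro _ ⟨h, hh, rfl⟩
        exact ⟨h * ContinuousMap.const X S, hIr h hh _, rfl⟩
      · rintro _ ⟨n, rfl⟩ η
        obtain ⟨h, hh, hht⟩ := hU n t (htU n) η
        exact Submodule.le_topologicalClosure _ ⟨h, hh, hht⟩
    obtain ⟨_, ⟨h, hh, rfl⟩, hlt⟩ := Metric.mem_closure_iff.1 hmem ε hε
    exact ⟨h, hh, by rwa [dist_eq_norm] at hlt⟩
  · exact ⟨0, I.zero_mem, by simpa [hf.2 t ht] using hε⟩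

theorem stmt16 (hdim : ¬ FiniteDimensional ℂ H) [TopologicalSpace.SeparableSpace H]
    (hX : ∀ S : Set X, IsMeagre S → IsNowhereDense S)
    (I : Submodule ℂ C(X, H →L[ℂ] H)) (hIr : IsRightIdealCM I)
    (hIc : IsClosed (I : Set C(X, H →L[ℂ] H))) (hIe : IsAlgEssentialCM I) :
    (∃ J : Submodule ℂ C(X, H →L[ℂ] H), IsTwoSidedIdealCM J ∧
      IsClosed (J : Set C(X, H →L[ℂ] H)) ∧ IsEssentialTwoSided J ∧ J ≤ I) ∧
    ∃ V : Set X, IsOpen V ∧ Dense V ∧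
      ∀ f : C(X, H →L[ℂ] H), (∀ t : X, IsCompactOperator (f t)) →
        (∀ t : X, t ∉ V → f t = 0) → f ∈ I := by
  obtain ⟨V, hVo, hVd, hV⟩ := hIe.exists_compactVanishingOff_le hX hIr hIc
  exact ⟨⟨compactVanishingOff X H V, isTwoSidedIdealCM_compactVanishingOff V,
    isClosed_compactVanishingOff V, isEssentialTwoSided_compactVanishingOff hVo hVd, hV⟩,
    V, hVo, hVd, fun f hf hfV ↦ hV ⟨hf, hfV⟩⟩
end
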